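/- Let F = α + εβ²/α (ε ∈ {1,−1}) be a regular Douglas (α,β)-metric on an open subset U ⊆ ℝ² with β nowhere zero. Then around each point there exist local coordinates (x¹,x²) and smooth scalar functions B(x), u(x), v(x) such that u + iv is a complex analytic function of z = x¹ + ix², 0 < B < 1 if ε = 1 and 0 < B < 1/2 if ε = −1, and α² = (1−εB)⁻³ { B[(y¹)²+(y²)²]/(u²+v²) − 9ε(1+εB+B²)β² } and β = B(uy¹+vy²)/[(1+2εB)^{3/2}(u²+v²)]. -/

import Mathlib

open scoped BigOperators
open Real

noncomputable section

/-- Points (and vectors) of the plane. -/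
abbrev Pt : Type := Fin 2 → ℝ

/-- Partial derivative of a scalar function on `ℝ²` in the `j`-th coordinate direction. -/
def pd (f : Pt → ℝ) (j : Fin 2) (x : Pt) : ℝ := fderiv ℝ f x (Pi.single j 1)

/-- Christoffel symbols `γ^k_{ij}` of a Riemannian metric `a`. -/
def christoffel (a : Pt → Matrix (Fin 2) (Fin 2) ℝ) (k i j : Fin 2) (x : Pt) : ℝ :=
  (1/2) * ∑ l, (a x)⁻¹ k l *
    (pd (fun z => a z l j) i x + pd (fun z => a z l i) j x - pd (fun z => a z i j) l x)

/-- Covariant derivative `c_{i|j}` of a 1-form `c` with respect to the metric `a`. -/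
def covD (a : Pt → Matrix (Fin 2) (Fin 2) ℝ) (c : Pt → Fin 2 → ℝ) (i j : Fin 2) (x : Pt) : ℝ :=
  pd (fun z => c z i) j x - ∑ k, c x k * christoffel a k i j x

/-- `r_{ij}`, the symmetrized covariant derivative of the 1-form `b`. -/
def rr (a : Pt → Matrix (Fin 2) (Fin 2) ℝ) (b : Pt → Fin 2 → ℝ) (i j : Fin 2) (x : Pt) : ℝ :=
  (covD a b i j x + covD a b j i x) / 2

/-- `s_{ij}`, the antisymmetrized covariant derivative of the 1-form `b`. -/
def so (a : Pt → Matrix (Fin 2) (Fin 2) ℝ) (b : Pt → Fin 2 → ℝ) (i j : Fin 2) (x : Pt) : ℝ :=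
  (covD a b i j x - covD a b j i x) / 2

/-- `bⁱ := a^{ik} b_k`. -/
def bUp (a : Pt → Matrix (Fin 2) (Fin 2) ℝ) (b : Pt → Fin 2 → ℝ) (i : Fin 2) (x : Pt) : ℝ :=
  ∑ k, (a x)⁻¹ i k * b x k

/-- `b² := a^{ij} b_i b_j`, the squared norm of `β` with respect to `α`. -/
def bsq (a : Pt → Matrix (Fin 2) (Fin 2) ℝ) (b : Pt → Fin 2 → ℝ) (x : Pt) : ℝ :=
  ∑ i, bUp a b i x * b x i

/-- `s_j := bⁱ s_{ij}`. -/
def sLow (a : Pt → Matrix (Fin 2) (Fin 2) ℝ) (b : Pt → Fin 2 → ℝ) (j : Fin 2) (x : Pt) : ℝ :=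
  ∑ i, bUp a b i x * so a b i j x

/-- `sⁱ := a^{ik} s_k`. -/
def sUp (a : Pt → Matrix (Fin 2) (Fin 2) ℝ) (b : Pt → Fin 2 → ℝ) (i : Fin 2) (x : Pt) : ℝ :=
  ∑ k, (a x)⁻¹ i k * sLow a b k x

/-- `s₀ := s_j y^j`. -/
def sZero (a : Pt → Matrix (Fin 2) (Fin 2) ℝ) (b : Pt → Fin 2 → ℝ) (x : Pt) (y : Fin 2 → ℝ) : ℝ :=
  ∑ j, sLow a b j x * y j

/-- The Riemannian norm `α(x,y) = √(a_{ij} yⁱ yʲ)`. -/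
def alphaF (a : Pt → Matrix (Fin 2) (Fin 2) ℝ) (x : Pt) (y : Fin 2 → ℝ) : ℝ :=
  Real.sqrt (∑ i, ∑ j, a x i j * y i * y j)

/-- The 1-form `β(x,y) = b_i(x) yⁱ`. -/
def betaF (b : Pt → Fin 2 → ℝ) (x : Pt) (y : Fin 2 → ℝ) : ℝ := ∑ i, b x i * y i

/-- Fundamental tensor `g_{ij} := ½ [F²]_{yⁱyʲ}` of a Finsler metric `F`. -/
def gMat (F : Pt → (Fin 2 → ℝ) → ℝ) (x : Pt) (y : Fin 2 → ℝ) : Matrix (Fin 2) (Fin 2) ℝ :=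
  Matrix.of fun i j =>
    (1/2) * fderiv ℝ (fun y1 => fderiv ℝ (fun y2 => (F x y2)^2) y1 (Pi.single j 1)) y
      (Pi.single i 1)

/-- Spray coefficients `Gⁱ := ¼ g^{il} ([F²]_{x^k y^l} y^k − [F²]_{x^l})` of a Finsler metric. -/
def spray (F : Pt → (Fin 2 → ℝ) → ℝ) (i : Fin 2) (x : Pt) (y : Fin 2 → ℝ) : ℝ :=
  (1/4) * ∑ l, (gMat F x y)⁻¹ i l *
    ((∑ k, (fderiv ℝ (fun x' => fderiv ℝ (fun y' => (F x' y')^2) y (Pi.single l 1)) x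
        (Pi.single k 1)) * y k)
      - fderiv ℝ (fun x' => (F x' y)^2) x (Pi.single l 1))

/-- `F` is a Douglas metric on `U`: for each `x ∈ U`, `G¹y² − G²y¹` is a homogeneous
polynomial of degree 3 in `(y¹, y²)`. -/
def IsDouglasOn (F : Pt → (Fin 2 → ℝ) → ℝ) (U : Set Pt) : Prop :=
  ∀ x ∈ U, ∃ c0 c1 c2 c3 : ℝ, ∀ y : Fin 2 → ℝ, y ≠ 0 →
    spray F 0 x y * y 1 - spray F 1 x y * y 0 =
      c0 * (y 0)^3 + c1 * (y 0)^2 * y 1 + c2 * (y 0) * (y 1)^2 + c3 * (y 1)^3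

/-- The Hamel operator `F_{x^m y^l} y^m − F_{x^l}`. -/
def Hamel (F : Pt → (Fin 2 → ℝ) → ℝ) (x : Pt) (y : Fin 2 → ℝ) (l : Fin 2) : ℝ :=
  (∑ m, fderiv ℝ (fun x' => fderiv ℝ (fun y' => F x' y') y (Pi.single l 1)) x
      (Pi.single m 1) * y m)
    - fderiv ℝ (fun x' => F x' y) x (Pi.single l 1)

/-- `F` is projectively flat on `U` (Hamel equations). -/
def ProjFlatOn (F : Pt → (Fin 2 → ℝ) → ℝ) (U : Set Pt) : Prop :=
  ∀ x ∈ U, ∀ y : Fin 2 → ℝ, y ≠ 0 → ∀ l, Hamel F x y l = 0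

/-- Spray coefficients `G^i_α := ½ γ^i_{jk} y^j y^k` of the Riemannian metric `α`. -/
def sprayA (a : Pt → Matrix (Fin 2) (Fin 2) ℝ) (i : Fin 2) (x : Pt) (y : Fin 2 → ℝ) : ℝ :=
  (1/2) * ∑ j, ∑ k, christoffel a i j k x * y j * y k

/-- The projective factor `P = F_{x^m} y^m / (2F)`. -/
def projFac (F : Pt → (Fin 2 → ℝ) → ℝ) (x : Pt) (y : Fin 2 → ℝ) : ℝ :=
  (∑ m, fderiv ℝ (fun x' => F x' y) x (Pi.single m 1) * y m) / (2 * F x y)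

/-- Pullback of a Finsler metric under a coordinate map `ψ`. -/
def pullF (F : Pt → (Fin 2 → ℝ) → ℝ) (ψ : Pt → Pt) : Pt → (Fin 2 → ℝ) → ℝ :=
  fun z y => F (ψ z) (fderiv ℝ ψ z y)

/-- `ψ` is a (curvilinear) coordinate chart: a smooth injective map from the open set `V`
into `U` with everywhere invertible differential. -/
def IsCoordChart (ψ : Pt → Pt) (V U : Set Pt) : Prop :=
  IsOpen V ∧ ContDiffOn ℝ (⊤ : ℕ∞) ψ V ∧ Set.InjOn ψ V ∧ ψ '' V ⊆ U ∧
    ∀ z ∈ V, LinearMap.det ((fderiv ℝ ψ z) : Pt →ₗ[ℝ] Pt) ≠ 0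

/-- `F` is locally projectively flat on `U`: around every point there are local coordinates
in which `F` satisfies the Hamel equations. -/
def IsLocProjFlatOn (F : Pt → (Fin 2 → ℝ) → ℝ) (U : Set Pt) : Prop :=
  ∀ x ∈ U, ∃ (V : Set Pt) (ψ : Pt → Pt), IsCoordChart ψ V U ∧ x ∈ ψ '' V ∧
    ProjFlatOn (pullF F ψ) V


/-- The coefficient `B / (1 + 2εB)³` of `θ₀²` in the normal form of `α²`. -/
def coefP (ε B : ℝ) : ℝ := B / (1 + 2 * ε * B) ^ 3

/-- The coefficient `B / (1 - εB)³` of `θ₁²` in the normal form of `α²`. -/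
def coefQ (ε B : ℝ) : ℝ := B / (1 - ε * B) ^ 3

/-- The logarithmic derivative of `coefP ε`. -/
def logDerivP (ε B : ℝ) : ℝ := (1 - 4 * ε * B) / (B * (1 + 2 * ε * B))

/-- The logarithmic derivative of `coefQ ε`. -/
def logDerivQ (ε B : ℝ) : ℝ := (1 + 2 * ε * B) / (B * (1 - ε * B))

lemma hasDerivAt_coefP {ε B : ℝ} (hB : B ≠ 0) (h : 1 + 2 * ε * B ≠ 0) :
    HasDerivAt (coefP ε) (coefP ε B * logDerivP ε B) B := by
  have h1 : HasDerivAt (fun z : ℝ => 1 + 2 * ε * z) (2 * ε) B := by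
    simpa using ((hasDerivAt_id B).const_mul (2 * ε)).const_add 1
  refine ((hasDerivAt_id B).div (h1.pow 3) (pow_ne_zero 3 h)).congr_deriv ?_
  simp only [coefP, logDerivP, id, Pi.pow_apply]
  field_simp
  ring

lemma hasDerivAt_coefQ {ε B : ℝ} (hB : B ≠ 0) (h : 1 - ε * B ≠ 0) :
    HasDerivAt (coefQ ε) (coefQ ε B * logDerivQ ε B) B := by
  have h1 : HasDerivAt (fun z : ℝ => 1 - ε * z) (-ε) B := by
    simpa using ((hasDerivAt_id B).const_mul ε).const_sub 1
  refine ((hasDerivAt_id B).div (h1.pow 3) (pow_ne_zero 3 h)).congr_deriv ?_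
  simp only [coefQ, logDerivQ, id, Pi.pow_apply]
  field_simp
  ring

/-- `α²` as a quadratic form in the coframe `(θ₀, θ₁)`. -/
def quadA (p q t s : ℝ) : ℝ := p * t ^ 2 + q * s ^ 2

/-- `α F = α² + εβ²` as a quadratic form in the coframe. -/
def quadN (ε B p q t s : ℝ) : ℝ := (1 + ε * B) * p * t ^ 2 + q * s ^ 2

/-- `(1 + 2εb²)α² - 3εβ²` as a quadratic form in the coframe. -/
def quadK (ε B p q t s : ℝ) : ℝ := (1 - ε * B) * p * t ^ 2 + (1 + 2 * ε * B) * q * s ^ 2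

/-- `α³ ∂F/∂t`. -/
def gradT (ε B p q t s : ℝ) : ℝ :=
  p * t * ((1 + ε * B) * p * t ^ 2 + (1 + 2 * ε * B) * q * s ^ 2)

/-- `α³ ∂F/∂s`. -/
def gradS (ε B p q t s : ℝ) : ℝ := q * s * ((1 - ε * B) * p * t ^ 2 + q * s ^ 2)

/-- `F²` as a function of `B` and of the coframe components `t`, `s`. -/
def energy (ε B t s : ℝ) : ℝ :=
  quadN ε B (coefP ε B) (coefQ ε B) t s ^ 2 / quadA (coefP ε B) (coefQ ε B) t s

/-- `∂(F²)/∂t`. -/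
def energyT (ε B t s : ℝ) : ℝ :=
  2 * quadN ε B (coefP ε B) (coefQ ε B) t s * gradT ε B (coefP ε B) (coefQ ε B) t s /
    quadA (coefP ε B) (coefQ ε B) t s ^ 2

/-- `∂(F²)/∂s`. -/
def energyS (ε B t s : ℝ) : ℝ :=
  2 * quadN ε B (coefP ε B) (coefQ ε B) t s * gradS ε B (coefP ε B) (coefQ ε B) t s /
    quadA (coefP ε B) (coefQ ε B) t s ^ 2

/-- The derivative of `quadA` in `B`. -/
def quadAB (ε B p q t s : ℝ) : ℝ := p * logDerivP ε B * t ^ 2 + q * logDerivQ ε B * s ^ 2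

/-- The derivative of `quadN` in `B`. -/
def quadNB (ε B p q t s : ℝ) : ℝ :=
  ε * p * t ^ 2 + (1 + ε * B) * p * logDerivP ε B * t ^ 2 + q * logDerivQ ε B * s ^ 2

/-- The derivative of `gradT` in `B`. -/
def gradTB (ε B p q t s : ℝ) : ℝ :=
  p * t * (logDerivP ε B * ((1 + ε * B) * p * t ^ 2 + (1 + 2 * ε * B) * q * s ^ 2)
    + ε * p * t ^ 2 + 2 * ε * q * s ^ 2
    + (1 + ε * B) * p * logDerivP ε B * t ^ 2 + (1 + 2 * ε * B) * q * logDerivQ ε B * s ^ 2)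

/-- The derivative of `gradS` in `B`. -/
def gradSB (ε B p q t s : ℝ) : ℝ :=
  q * s * (logDerivQ ε B * ((1 - ε * B) * p * t ^ 2 + q * s ^ 2)
    - ε * p * t ^ 2 + (1 - ε * B) * p * logDerivP ε B * t ^ 2 + q * logDerivQ ε B * s ^ 2)

/-- `∂(F²)/∂B`. -/
def energyB (ε B t s : ℝ) : ℝ :=
  (2 * quadN ε B (coefP ε B) (coefQ ε B) t s * quadNB ε B (coefP ε B) (coefQ ε B) t s *
      quadA (coefP ε B) (coefQ ε B) t s
    - quadN ε B (coefP ε B) (coefQ ε B) t s ^ 2 * quadAB ε B (coefP ε B) (coefQ ε B) t s) /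
    quadA (coefP ε B) (coefQ ε B) t s ^ 2

/-- The derivative of `2 N M / A²` when `N`, `M`, `A` have derivatives `N'`, `M'`, `A'`. -/
def quotDeriv (N M A N' M' A' : ℝ) : ℝ :=
  2 * (N' * M + N * M') / A ^ 2 - 4 * N * M * A' / A ^ 3

/-- `∂²(F²)/∂t²`. -/
def energyTT (ε B p q t s : ℝ) : ℝ :=
  quotDeriv (quadN ε B p q t s) (gradT ε B p q t s) (quadA p q t s)
    (2 * (1 + ε * B) * p * t)
    (p * (3 * (1 + ε * B) * p * t ^ 2 + (1 + 2 * ε * B) * q * s ^ 2)) (2 * p * t)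

/-- `∂²(F²)/∂t∂s`. -/
def energyTS (ε B p q t s : ℝ) : ℝ :=
  quotDeriv (quadN ε B p q t s) (gradT ε B p q t s) (quadA p q t s)
    (2 * q * s) (2 * (1 + 2 * ε * B) * p * q * t * s) (2 * q * s)

/-- `∂²(F²)/∂s²`. -/
def energySS (ε B p q t s : ℝ) : ℝ :=
  quotDeriv (quadN ε B p q t s) (gradS ε B p q t s) (quadA p q t s)
    (2 * q * s) (q * ((1 - ε * B) * p * t ^ 2 + 3 * q * s ^ 2)) (2 * q * s)

/-- `∂²(F²)/∂t∂B`. -/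
def energyTB (ε B p q t s : ℝ) : ℝ :=
  quotDeriv (quadN ε B p q t s) (gradT ε B p q t s) (quadA p q t s)
    (quadNB ε B p q t s) (gradTB ε B p q t s) (quadAB ε B p q t s)

/-- `∂²(F²)/∂s∂B`. -/
def energySB (ε B p q t s : ℝ) : ℝ :=
  quotDeriv (quadN ε B p q t s) (gradS ε B p q t s) (quadA p q t s)
    (quadNB ε B p q t s) (gradSB ε B p q t s) (quadAB ε B p q t s)

section Algebra

variable {ε B p q t s : ℝ}

lemma energyTS_eq (hA : quadA p q t s ≠ 0) :
    energyTS ε B p q t s =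
      quotDeriv (quadN ε B p q t s) (gradS ε B p q t s) (quadA p q t s)
        (2 * (1 + ε * B) * p * t) (2 * (1 - ε * B) * p * q * t * s) (2 * p * t) := by
  simp only [energyTS, quotDeriv]
  field_simp
  simp only [quadN, gradT, gradS, quadA]
  ring

lemma euler_energyT (hA : quadA p q t s ≠ 0) :
    energyTT ε B p q t s * t + energyTS ε B p q t s * s =
      2 * quadN ε B p q t s * gradT ε B p q t s / quadA p q t s ^ 2 := by
  simp only [energyTT, energyTS, quotDeriv]
  field_simp
  simp only [quadN, gradT, quadA]
  ring

lemma euler_energyS (hA : quadA p q t s ≠ 0) :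
    energyTS ε B p q t s * t + energySS ε B p q t s * s =
      2 * quadN ε B p q t s * gradS ε B p q t s / quadA p q t s ^ 2 := by
  rw [energyTS_eq hA]
  simp only [energySS, quotDeriv]
  field_simp
  simp only [quadN, gradS, quadA]
  ring

lemma euler_quadN :
    t * gradT ε B p q t s + s * gradS ε B p q t s = quadN ε B p q t s * quadA p q t s := by
  simp only [quadN, gradT, gradS, quadA]
  ring

lemma hessian_det (hA : quadA p q t s ≠ 0) :
    energyTT ε B p q t s * energySS ε B p q t s - energyTS ε B p q t s ^ 2 =
      4 * p * q * quadN ε B p q t s ^ 3 * quadK ε B p q t s / quadA p q t s ^ 4 := by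
  simp only [energyTT, energySS, energyTS, quotDeriv]
  field_simp
  simp only [quadN, gradT, gradS, quadA, quadK]
  ring

lemma gradTB_mod_quadK (hε : ε = 1 ∨ ε = -1) (hB : B ≠ 0) (h1 : 1 + 2 * ε * B ≠ 0)
    (h2 : 1 - ε * B ≠ 0) :
    gradTB ε B p q t s * quadA p q t s - 3 / 2 * gradT ε B p q t s * quadAB ε B p q t s =
      p * t * quadK ε B p q t s * ((1 - ε * B) * p * t ^ 2 + (1 - 10 * ε * B) * q * s ^ 2) /
        (2 * B * (1 + 2 * ε * B) * (1 - ε * B)) := by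
  simp only [quadA, quadK, gradTB, gradT, quadAB, logDerivP, logDerivQ]
  obtain ⟨c, hc⟩ : ∃ c, c = 1 + 2 * ε * B := ⟨_, rfl⟩
  obtain ⟨d, hd⟩ : ∃ d, d = 1 - ε * B := ⟨_, rfl⟩
  simp only [← hc, ← hd] at h1 h2 ⊢
  field_simp
  subst hc hd
  rcases hε with rfl | rfl <;> ring

lemma gradSB_mod_quadK (hε : ε = 1 ∨ ε = -1) (hB : B ≠ 0) (h1 : 1 + 2 * ε * B ≠ 0)
    (h2 : 1 - ε * B ≠ 0) :
    gradSB ε B p q t s * quadA p q t s - 3 / 2 * gradS ε B p q t s * quadAB ε B p q t s =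
      q * s * quadK ε B p q t s * ((1 + 11 * ε * B) * p * t ^ 2 + (1 + 2 * ε * B) * q * s ^ 2) /
        (2 * B * (1 + 2 * ε * B) * (1 - ε * B)) := by
  simp only [quadA, quadK, gradSB, gradS, quadAB, logDerivP, logDerivQ]
  obtain ⟨c, hc⟩ : ∃ c, c = 1 + 2 * ε * B := ⟨_, rfl⟩
  obtain ⟨d, hd⟩ : ∃ d, d = 1 - ε * B := ⟨_, rfl⟩
  simp only [← hc, ← hd] at h1 h2 ⊢
  field_simp
  subst hc hd
  rcases hε with rfl | rfl <;> ring

lemma euler_quadNB :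
    t * gradTB ε B p q t s + s * gradSB ε B p q t s =
      quadNB ε B p q t s * quadA p q t s + quadN ε B p q t s * quadAB ε B p q t s := by
  simp only [quadN, quadNB, gradTB, gradSB, quadA, quadAB]
  ring

end Algebra

section Calculus

variable {E : Type*} [NormedAddCommGroup E] [NormedSpace ℝ E] {ε : ℝ} {x : E}

lemma hasFDerivAt_quotDeriv {N M A : E → ℝ} {N' M' A' D : E →L[ℝ] ℝ} (hN : HasFDerivAt N N' x)
    (hM : HasFDerivAt M M' x) (hA : HasFDerivAt A A' x) (hA0 : A x ≠ 0)
    (hD : ∀ v, D v = quotDeriv (N x) (M x) (A x) (N' v) (M' v) (A' v)) :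
    HasFDerivAt (fun z => 2 * N z * M z / A z ^ 2) D x := by
  refine (((hN.const_mul 2).mul hM).mul ((hasDerivAt_inv (pow_ne_zero 2 hA0)).comp_hasFDerivAt x
    (hA.pow 2))).congr_fderiv ?_
  ext v
  simp [hD, quotDeriv]
  field_simp
  ring

variable {B t s : E → ℝ} {B' t' s' : E →L[ℝ] ℝ}

lemma hasFDerivAt_quadA (hB : HasFDerivAt B B' x) (ht : HasFDerivAt t t' x)
    (hs : HasFDerivAt s s' x) (hB0 : B x ≠ 0) (h1 : 1 + 2 * ε * B x ≠ 0)
    (h2 : 1 - ε * B x ≠ 0) :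
    HasFDerivAt (fun z => quadA (coefP ε (B z)) (coefQ ε (B z)) (t z) (s z))
      ((2 * coefP ε (B x) * t x) • t' + (2 * coefQ ε (B x) * s x) • s' +
        quadAB ε (B x) (coefP ε (B x)) (coefQ ε (B x)) (t x) (s x) • B') x := by
  have hp := (hasDerivAt_coefP hB0 h1).comp_hasFDerivAt x hB
  have hq := (hasDerivAt_coefQ hB0 h2).comp_hasFDerivAt x hB
  refine ((hp.mul (ht.pow 2)).add (hq.mul (hs.pow 2))).congr_fderiv ?_
  ext v
  simp [quadAB]
  ring

lemma hasFDerivAt_quadN (hB : HasFDerivAt B B' x) (ht : HasFDerivAt t t' x)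
    (hs : HasFDerivAt s s' x) (hB0 : B x ≠ 0) (h1 : 1 + 2 * ε * B x ≠ 0)
    (h2 : 1 - ε * B x ≠ 0) :
    HasFDerivAt (fun z => quadN ε (B z) (coefP ε (B z)) (coefQ ε (B z)) (t z) (s z))
      ((2 * (1 + ε * B x) * coefP ε (B x) * t x) • t' + (2 * coefQ ε (B x) * s x) • s' +
        quadNB ε (B x) (coefP ε (B x)) (coefQ ε (B x)) (t x) (s x) • B') x := by
  have hp := (hasDerivAt_coefP hB0 h1).comp_hasFDerivAt x hB
  have hq := (hasDerivAt_coefQ hB0 h2).comp_hasFDerivAt x hB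
  refine (((((hB.const_mul ε).const_add 1).mul hp).mul (ht.pow 2)).add
    (hq.mul (hs.pow 2))).congr_fderiv ?_
  ext v
  simp [quadNB]
  ring

lemma hasFDerivAt_gradT (hB : HasFDerivAt B B' x) (ht : HasFDerivAt t t' x)
    (hs : HasFDerivAt s s' x) (hB0 : B x ≠ 0) (h1 : 1 + 2 * ε * B x ≠ 0)
    (h2 : 1 - ε * B x ≠ 0) :
    HasFDerivAt (fun z => gradT ε (B z) (coefP ε (B z)) (coefQ ε (B z)) (t z) (s z))
      ((coefP ε (B x) * (3 * (1 + ε * B x) * coefP ε (B x) * t x ^ 2 +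
          (1 + 2 * ε * B x) * coefQ ε (B x) * s x ^ 2)) • t' +
        (2 * (1 + 2 * ε * B x) * coefP ε (B x) * coefQ ε (B x) * t x * s x) • s' +
        gradTB ε (B x) (coefP ε (B x)) (coefQ ε (B x)) (t x) (s x) • B') x := by
  have hp := (hasDerivAt_coefP hB0 h1).comp_hasFDerivAt x hB
  have hq := (hasDerivAt_coefQ hB0 h2).comp_hasFDerivAt x hB
  refine ((hp.mul ht).mul (((((hB.const_mul ε).const_add 1).mul hp).mul (ht.pow 2)).add
    ((((hB.const_mul (2 * ε)).const_add 1).mul hq).mul (hs.pow 2)))).congr_fderiv ?_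
  ext v
  simp [gradTB]
  ring

lemma hasFDerivAt_gradS (hB : HasFDerivAt B B' x) (ht : HasFDerivAt t t' x)
    (hs : HasFDerivAt s s' x) (hB0 : B x ≠ 0) (h1 : 1 + 2 * ε * B x ≠ 0)
    (h2 : 1 - ε * B x ≠ 0) :
    HasFDerivAt (fun z => gradS ε (B z) (coefP ε (B z)) (coefQ ε (B z)) (t z) (s z))
      ((2 * (1 - ε * B x) * coefP ε (B x) * coefQ ε (B x) * t x * s x) • t' +
        (coefQ ε (B x) * ((1 - ε * B x) * coefP ε (B x) * t x ^ 2 +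
          3 * coefQ ε (B x) * s x ^ 2)) • s' +
        gradSB ε (B x) (coefP ε (B x)) (coefQ ε (B x)) (t x) (s x) • B') x := by
  have hp := (hasDerivAt_coefP hB0 h1).comp_hasFDerivAt x hB
  have hq := (hasDerivAt_coefQ hB0 h2).comp_hasFDerivAt x hB
  refine ((hq.mul hs).mul (((((hB.const_mul ε).const_sub 1).mul hp).mul (ht.pow 2)).add
    (hq.mul (hs.pow 2)))).congr_fderiv ?_
  ext v
  simp [gradSB]
  ring

lemma hasFDerivAt_energy (hB : HasFDerivAt B B' x) (ht : HasFDerivAt t t' x)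
    (hs : HasFDerivAt s s' x) (hB0 : B x ≠ 0) (h1 : 1 + 2 * ε * B x ≠ 0) (h2 : 1 - ε * B x ≠ 0)
    (hA : quadA (coefP ε (B x)) (coefQ ε (B x)) (t x) (s x) ≠ 0) :
    HasFDerivAt (fun z => energy ε (B z) (t z) (s z))
      (energyT ε (B x) (t x) (s x) • t' + energyS ε (B x) (t x) (s x) • s' +
        energyB ε (B x) (t x) (s x) • B') x := by
  refine (((hasFDerivAt_quadN hB ht hs hB0 h1 h2).pow 2).mul ((hasDerivAt_inv hA).comp_hasFDerivAt
    x (hasFDerivAt_quadA hB ht hs hB0 h1 h2))).congr_fderiv ?_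
  ext v
  simp [energyT, energyS, energyB]
  field_simp
  simp only [gradT, gradS, quadN, quadA]
  ring

lemma hasFDerivAt_energyT (hB : HasFDerivAt B B' x) (ht : HasFDerivAt t t' x)
    (hs : HasFDerivAt s s' x) (hB0 : B x ≠ 0) (h1 : 1 + 2 * ε * B x ≠ 0) (h2 : 1 - ε * B x ≠ 0)
    (hA : quadA (coefP ε (B x)) (coefQ ε (B x)) (t x) (s x) ≠ 0) :
    HasFDerivAt (fun z => energyT ε (B z) (t z) (s z))
      (energyTT ε (B x) (coefP ε (B x)) (coefQ ε (B x)) (t x) (s x) • t' +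
        energyTS ε (B x) (coefP ε (B x)) (coefQ ε (B x)) (t x) (s x) • s' +
        energyTB ε (B x) (coefP ε (B x)) (coefQ ε (B x)) (t x) (s x) • B') x := by
  refine hasFDerivAt_quotDeriv (hasFDerivAt_quadN hB ht hs hB0 h1 h2)
    (hasFDerivAt_gradT hB ht hs hB0 h1 h2) (hasFDerivAt_quadA hB ht hs hB0 h1 h2) hA fun v => ?_
  simp [energyTT, energyTS, energyTB, quotDeriv]
  ring

lemma hasFDerivAt_energyS (hB : HasFDerivAt B B' x) (ht : HasFDerivAt t t' x)
    (hs : HasFDerivAt s s' x) (hB0 : B x ≠ 0) (h1 : 1 + 2 * ε * B x ≠ 0) (h2 : 1 - ε * B x ≠ 0)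
    (hA : quadA (coefP ε (B x)) (coefQ ε (B x)) (t x) (s x) ≠ 0) :
    HasFDerivAt (fun z => energyS ε (B z) (t z) (s z))
      (energyTS ε (B x) (coefP ε (B x)) (coefQ ε (B x)) (t x) (s x) • t' +
        energySS ε (B x) (coefP ε (B x)) (coefQ ε (B x)) (t x) (s x) • s' +
        energySB ε (B x) (coefP ε (B x)) (coefQ ε (B x)) (t x) (s x) • B') x := by
  refine hasFDerivAt_quotDeriv (hasFDerivAt_quadN hB ht hs hB0 h1 h2)
    (hasFDerivAt_gradS hB ht hs hB0 h1 h2) (hasFDerivAt_quadA hB ht hs hB0 h1 h2) hA fun v => ?_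
  rw [energyTS_eq hA]
  simp [energySS, energySB, quotDeriv]
  ring

end Calculus

/-- The covector `E_{x^k y^l} y^k - E_{x^l}` of `E = F²`, so that `Gⁱ = ¼ g^{il} sprayForce l`. -/
def sprayForce (F : Pt → (Fin 2 → ℝ) → ℝ) (x : Pt) (y : Fin 2 → ℝ) (l : Fin 2) : ℝ :=
  (∑ k, (fderiv ℝ (fun x' => fderiv ℝ (fun y' => (F x' y')^2) y (Pi.single l 1)) x
      (Pi.single k 1)) * y k)
    - fderiv ℝ (fun x' => (F x' y)^2) x (Pi.single l 1)

lemma spray_cross {F : Pt → (Fin 2 → ℝ) → ℝ} {x : Pt} {y : Fin 2 → ℝ}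
    (hg : (gMat F x y).det ≠ 0) :
    4 * (gMat F x y).det * (spray F 0 x y * y 1 - spray F 1 x y * y 0) =
      (gMat F x y 1 0 * y 0 + gMat F x y 1 1 * y 1) * sprayForce F x y 0 -
        (gMat F x y 0 0 * y 0 + gMat F x y 0 1 * y 1) * sprayForce F x y 1 := by
  have hs : ∀ i, spray F i x y = 1 / 4 * ∑ l, (gMat F x y)⁻¹ i l * sprayForce F x y l :=
    fun _ => rfl
  rw [hs, hs]
  generalize gMat F x y = g at *
  rw [Matrix.inv_def, Ring.inverse_eq_inv', Matrix.adjugate_fin_two]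
  simp only [Fin.sum_univ_two, Matrix.smul_apply, smul_eq_mul, Matrix.of_apply, Matrix.cons_val',
    Matrix.cons_val_zero, Matrix.cons_val_one, Matrix.cons_val_fin_one]
  field_simp
  ring

/-- The linear form with coefficient vector `c`. -/
def linForm (c : Pt) : Pt →L[ℝ] ℝ :=
  c 0 • ContinuousLinearMap.proj 0 + c 1 • ContinuousLinearMap.proj 1

lemma linForm_apply (c y : Pt) : linForm c y = c 0 * y 0 + c 1 * y 1 := by
  simp [linForm]

lemma linForm_single (c : Pt) (l : Fin 2) : linForm c (Pi.single l 1) = c l := by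
  fin_cases l <;> simp [linForm_apply]

/-- The bounds on `B` that regularity of the metric provides. -/
def Admissible (ε B : ℝ) : Prop := 0 < B ∧ 0 < 1 + 2 * ε * B ∧ 0 < 1 - ε * B

namespace Admissible

variable {ε B : ℝ}

lemma ne_zero (h : Admissible ε B) : B ≠ 0 := h.1.ne'

lemma ne_one (h : Admissible ε B) : 1 + 2 * ε * B ≠ 0 := h.2.1.ne'

lemma ne_two (h : Admissible ε B) : 1 - ε * B ≠ 0 := h.2.2.ne'

lemma coefP_pos (h : Admissible ε B) : 0 < coefP ε B := div_pos h.1 (pow_pos h.2.1 3)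

lemma coefQ_pos (h : Admissible ε B) : 0 < coefQ ε B := div_pos h.1 (pow_pos h.2.2 3)

end Admissible

/-- A diagonal quadratic form with positive coefficients is positive away from zero. -/
lemma diag_pos {a b t s : ℝ} (ha : 0 < a) (hb : 0 < b) (h : t ≠ 0 ∨ s ≠ 0) :
    0 < a * t ^ 2 + b * s ^ 2 := by
  rcases h with h | h
  · have := mul_pos ha (pow_pos (abs_pos.2 h) 2)
    rw [sq_abs] at this
    nlinarith [mul_nonneg hb.le (sq_nonneg s)]
  · have := mul_pos hb (pow_pos (abs_pos.2 h) 2)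
    rw [sq_abs] at this
    nlinarith [mul_nonneg ha.le (sq_nonneg t)]

/-- The squared metric `F²` written in a coframe `(θ, η)`. -/
structure CoframeData (ε : ℝ) (U : Set Pt) (F : Pt → (Fin 2 → ℝ) → ℝ)
    (B : Pt → ℝ) (θ η : Pt → Pt) : Prop where
  isOpen : IsOpen U
  adm : ∀ x ∈ U, Admissible ε (B x)
  det_ne : ∀ x ∈ U, θ x 0 * η x 1 - θ x 1 * η x 0 ≠ 0
  diffB : ∀ x ∈ U, DifferentiableAt ℝ B x
  diffθ : ∀ x ∈ U, ∀ i, DifferentiableAt ℝ (fun z => θ z i) x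
  diffη : ∀ x ∈ U, ∀ i, DifferentiableAt ℝ (fun z => η z i) x
  sq_eq : ∀ x ∈ U, ∀ y, F x y ^ 2 = energy ε (B x) (linForm (θ x) y) (linForm (η x) y)

namespace CoframeData

variable {ε : ℝ} {U : Set Pt} {F : Pt → (Fin 2 → ℝ) → ℝ} {B : Pt → ℝ} {θ η : Pt → Pt}
  {x y : Pt}

lemma linForm_ne (h : CoframeData ε U F B θ η) (hx : x ∈ U)
    (hy : y ≠ 0) : linForm (θ x) y ≠ 0 ∨ linForm (η x) y ≠ 0 := by
  by_contra! hc
  simp only [linForm_apply] at hc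
  have hJ := h.det_ne x hx
  apply hy
  have h0 : y 0 = 0 := by
    refine (mul_eq_zero.1 ?_).resolve_left hJ
    linear_combination η x 1 * hc.1 - θ x 1 * hc.2
  have h1 : y 1 = 0 := by
    refine (mul_eq_zero.1 ?_).resolve_left hJ
    linear_combination θ x 0 * hc.2 - η x 0 * hc.1
  ext i
  fin_cases i <;> simp [h0, h1]

lemma quadA_pos (h : CoframeData ε U F B θ η) (hx : x ∈ U) (hy : y ≠ 0) :
    0 < quadA (coefP ε (B x)) (coefQ ε (B x)) (linForm (θ x) y) (linForm (η x) y) :=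
  diag_pos (h.adm x hx).coefP_pos (h.adm x hx).coefQ_pos (h.linForm_ne hx hy)

lemma fderiv_sq (h : CoframeData ε U F B θ η) (hx : x ∈ U) (hy : y ≠ 0) (l : Fin 2) :
    fderiv ℝ (fun y' => F x y' ^ 2) y (Pi.single l 1) =
      energyT ε (B x) (linForm (θ x) y) (linForm (η x) y) * θ x l +
      energyS ε (B x) (linForm (θ x) y) (linForm (η x) y) * η x l := by
  have ad := h.adm x hx
  rw [funext (h.sq_eq x hx), (hasFDerivAt_energy (hasFDerivAt_const (B x) y)
    (linForm (θ x)).hasFDerivAt (linForm (η x)).hasFDerivAt ad.ne_zero ad.ne_one ad.ne_two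
    (h.quadA_pos hx hy).ne').fderiv]
  simp [linForm_single]

lemma gMat_apply (h : CoframeData ε U F B θ η) (hx : x ∈ U) (hy : y ≠ 0) (i j : Fin 2) :
    gMat F x y i j = 1 / 2 *
      ((energyTT ε (B x) (coefP ε (B x)) (coefQ ε (B x)) (linForm (θ x) y) (linForm (η x) y) *
          θ x i +
        energyTS ε (B x) (coefP ε (B x)) (coefQ ε (B x)) (linForm (θ x) y) (linForm (η x) y) *
          η x i) * θ x j +
      (energyTS ε (B x) (coefP ε (B x)) (coefQ ε (B x)) (linForm (θ x) y) (linForm (η x) y) *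
          θ x i +
        energySS ε (B x) (coefP ε (B x)) (coefQ ε (B x)) (linForm (θ x) y) (linForm (η x) y) *
          η x i) * η x j) := by
  have ad := h.adm x hx
  have hev : (fun y₁ => fderiv ℝ (fun y₂ => F x y₂ ^ 2) y₁ (Pi.single j 1)) =ᶠ[nhds y]
      fun y₁ => energyT ε (B x) (linForm (θ x) y₁) (linForm (η x) y₁) * θ x j +
        energyS ε (B x) (linForm (θ x) y₁) (linForm (η x) y₁) * η x j := by
    filter_upwards [isOpen_ne.mem_nhds hy] with y₁ hy₁
    exact h.fderiv_sq hx hy₁ j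
  have hT := hasFDerivAt_energyT (hasFDerivAt_const (B x) y) (linForm (θ x)).hasFDerivAt
    (linForm (η x)).hasFDerivAt ad.ne_zero ad.ne_one ad.ne_two (h.quadA_pos hx hy).ne'
  have hS := hasFDerivAt_energyS (hasFDerivAt_const (B x) y) (linForm (θ x)).hasFDerivAt
    (linForm (η x)).hasFDerivAt ad.ne_zero ad.ne_one ad.ne_two (h.quadA_pos hx hy).ne'
  rw [gMat, Matrix.of_apply, hev.fderiv_eq,
    ((hT.mul_const (θ x j)).fun_add (hS.mul_const (η x j))).fderiv]
  simp [linForm_single]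
  ring

lemma hasFDerivAt_linForm_left (h : CoframeData ε U F B θ η) (hx : x ∈ U) (y : Pt) :
    HasFDerivAt (fun z => linForm (θ z) y)
      (y 0 • fderiv ℝ (fun z => θ z 0) x + y 1 • fderiv ℝ (fun z => θ z 1) x) x := by
  simp only [linForm_apply]
  exact ((h.diffθ x hx 0).hasFDerivAt.mul_const (y 0)).add
    ((h.diffθ x hx 1).hasFDerivAt.mul_const (y 1))

lemma hasFDerivAt_linForm_right (h : CoframeData ε U F B θ η) (hx : x ∈ U) (y : Pt) :
    HasFDerivAt (fun z => linForm (η z) y)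
      (y 0 • fderiv ℝ (fun z => η z 0) x + y 1 • fderiv ℝ (fun z => η z 1) x) x := by
  simp only [linForm_apply]
  exact ((h.diffη x hx 0).hasFDerivAt.mul_const (y 0)).add
    ((h.diffη x hx 1).hasFDerivAt.mul_const (y 1))

lemma fderiv_sq_base (h : CoframeData ε U F B θ η) (hx : x ∈ U) (hy : y ≠ 0) (l : Fin 2) :
    fderiv ℝ (fun x' => F x' y ^ 2) x (Pi.single l 1) =
      energyT ε (B x) (linForm (θ x) y) (linForm (η x) y) *
        (y 0 * pd (fun z => θ z 0) l x + y 1 * pd (fun z => θ z 1) l x) +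
      energyS ε (B x) (linForm (θ x) y) (linForm (η x) y) *
        (y 0 * pd (fun z => η z 0) l x + y 1 * pd (fun z => η z 1) l x) +
      energyB ε (B x) (linForm (θ x) y) (linForm (η x) y) * pd B l x := by
  have ad := h.adm x hx
  have hev : (fun x' => F x' y ^ 2) =ᶠ[nhds x]
      fun x' => energy ε (B x') (linForm (θ x') y) (linForm (η x') y) := by
    filter_upwards [h.isOpen.mem_nhds hx] with x' hx'
    exact h.sq_eq x' hx' y
  rw [hev.fderiv_eq, (hasFDerivAt_energy (h.diffB x hx).hasFDerivAt
    (h.hasFDerivAt_linForm_left hx y) (h.hasFDerivAt_linForm_right hx y) ad.ne_zero ad.ne_one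
    ad.ne_two (h.quadA_pos hx hy).ne').fderiv]
  simp [pd]
  ring

lemma fderiv_fderiv_sq (h : CoframeData ε U F B θ η) (hx : x ∈ U) (hy : y ≠ 0) (k l : Fin 2) :
    fderiv ℝ (fun x' => fderiv ℝ (fun y' => F x' y' ^ 2) y (Pi.single l 1)) x (Pi.single k 1) =
      (energyTT ε (B x) (coefP ε (B x)) (coefQ ε (B x)) (linForm (θ x) y) (linForm (η x) y) *
          (y 0 * pd (fun z => θ z 0) k x + y 1 * pd (fun z => θ z 1) k x) +
        energyTS ε (B x) (coefP ε (B x)) (coefQ ε (B x)) (linForm (θ x) y) (linForm (η x) y) *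
          (y 0 * pd (fun z => η z 0) k x + y 1 * pd (fun z => η z 1) k x) +
        energyTB ε (B x) (coefP ε (B x)) (coefQ ε (B x)) (linForm (θ x) y) (linForm (η x) y) *
          pd B k x) * θ x l +
      energyT ε (B x) (linForm (θ x) y) (linForm (η x) y) * pd (fun z => θ z l) k x +
      ((energyTS ε (B x) (coefP ε (B x)) (coefQ ε (B x)) (linForm (θ x) y) (linForm (η x) y) *
          (y 0 * pd (fun z => θ z 0) k x + y 1 * pd (fun z => θ z 1) k x) +
        energySS ε (B x) (coefP ε (B x)) (coefQ ε (B x)) (linForm (θ x) y) (linForm (η x) y) *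
          (y 0 * pd (fun z => η z 0) k x + y 1 * pd (fun z => η z 1) k x) +
        energySB ε (B x) (coefP ε (B x)) (coefQ ε (B x)) (linForm (θ x) y) (linForm (η x) y) *
          pd B k x) * η x l +
      energyS ε (B x) (linForm (θ x) y) (linForm (η x) y) * pd (fun z => η z l) k x) := by
  have ad := h.adm x hx
  have hev : (fun x' => fderiv ℝ (fun y' => F x' y' ^ 2) y (Pi.single l 1)) =ᶠ[nhds x]
      fun x' => energyT ε (B x') (linForm (θ x') y) (linForm (η x') y) * θ x' l +
        energyS ε (B x') (linForm (θ x') y) (linForm (η x') y) * η x' l := by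
    filter_upwards [h.isOpen.mem_nhds hx] with x' hx'
    exact h.fderiv_sq hx' hy l
  have hT := hasFDerivAt_energyT (h.diffB x hx).hasFDerivAt
    (h.hasFDerivAt_linForm_left hx y) (h.hasFDerivAt_linForm_right hx y) ad.ne_zero ad.ne_one
    ad.ne_two (h.quadA_pos hx hy).ne'
  have hS := hasFDerivAt_energyS (h.diffB x hx).hasFDerivAt
    (h.hasFDerivAt_linForm_left hx y) (h.hasFDerivAt_linForm_right hx y) ad.ne_zero ad.ne_one
    ad.ne_two (h.quadA_pos hx hy).ne'
  rw [hev.fderiv_eq, ((hT.fun_mul (h.diffθ x hx l).hasFDerivAt).fun_add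
    (hS.fun_mul (h.diffη x hx l).hasFDerivAt)).fderiv]
  simp [pd]
  ring

end CoframeData

/-- The numerator of `G⁰y¹ - G¹y⁰` for a function of the coframe components: it is the Hessian
determinant times a cubic form, up to `B`-derivatives and the exterior derivatives of the
coframe. -/
lemma cross_force_identity {TT TS SS T S TB SB EB t s E2 y₀ y₁ θ₀ θ₁ η₀ η₁ B₀ B₁ θ₀₀ θ₀₁ θ₁₀ θ₁₁
    η₀₀ η₀₁ η₁₀ η₁₁ J X₀ X₁ : ℝ} (ht : t = θ₀ * y₀ + θ₁ * y₁) (hs : s = η₀ * y₀ + η₁ * y₁)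
    (hT : TT * t + TS * s = T) (hS : TS * t + SS * s = S) (hE : t * T + s * S = E2)
    (hJ : J = θ₀ * η₁ - θ₁ * η₀)
    (hX₀ : X₀ = ((TT * (y₀ * θ₀₀ + y₁ * θ₁₀) + TS * (y₀ * η₀₀ + y₁ * η₁₀) + TB * B₀) * θ₀
          + T * θ₀₀ + ((TS * (y₀ * θ₀₀ + y₁ * θ₁₀) + SS * (y₀ * η₀₀ + y₁ * η₁₀) + SB * B₀) * η₀
          + S * η₀₀)) * y₀
        + ((TT * (y₀ * θ₀₁ + y₁ * θ₁₁) + TS * (y₀ * η₀₁ + y₁ * η₁₁) + TB * B₁) * θ₀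
          + T * θ₀₁ + ((TS * (y₀ * θ₀₁ + y₁ * θ₁₁) + SS * (y₀ * η₀₁ + y₁ * η₁₁) + SB * B₁) * η₀
          + S * η₀₁)) * y₁
        - (T * (y₀ * θ₀₀ + y₁ * θ₁₀) + S * (y₀ * η₀₀ + y₁ * η₁₀) + EB * B₀))
    (hX₁ : X₁ = ((TT * (y₀ * θ₀₀ + y₁ * θ₁₀) + TS * (y₀ * η₀₀ + y₁ * η₁₀) + TB * B₀) * θ₁
          + T * θ₁₀ + ((TS * (y₀ * θ₀₀ + y₁ * θ₁₀) + SS * (y₀ * η₀₀ + y₁ * η₁₀) + SB * B₀) * η₁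
          + S * η₁₀)) * y₀
        + ((TT * (y₀ * θ₀₁ + y₁ * θ₁₁) + TS * (y₀ * η₀₁ + y₁ * η₁₁) + TB * B₁) * θ₁
          + T * θ₁₁ + ((TS * (y₀ * θ₀₁ + y₁ * θ₁₁) + SS * (y₀ * η₀₁ + y₁ * η₁₁) + SB * B₁) * η₁
          + S * η₁₁)) * y₁
        - (T * (y₀ * θ₀₁ + y₁ * θ₁₁) + S * (y₀ * η₀₁ + y₁ * η₁₁) + EB * B₁)) :
    (T * θ₁ + S * η₁) * X₀ - (T * θ₀ + S * η₀) * X₁ =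
      J * (TT * SS - TS ^ 2) *
          (s * ((y₀ * θ₀₀ + y₁ * θ₁₀) * y₀ + (y₀ * θ₀₁ + y₁ * θ₁₁) * y₁)
            - t * ((y₀ * η₀₀ + y₁ * η₁₀) * y₀ + (y₀ * η₀₁ + y₁ * η₁₁) * y₁))
        + (B₀ * η₁ - B₁ * η₀) * (t * (S * TB - T * SB) - EB * S)
        + (θ₀ * B₁ - θ₁ * B₀) * (s * (S * TB - T * SB) + EB * T)
        + E2 * (T * (θ₀₁ - θ₁₀) + S * (η₀₁ - η₁₀)) := by
  subst hX₀ hX₁ hE hJ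
  subst hT hS
  subst ht hs
  ring

section Algebra

variable {ε B p q t s N M₁ M₂ A NB TB SB AB : ℝ}

lemma cross_quotDeriv_left (hA : A ≠ 0) (e1 : t * M₁ + s * M₂ = N * A)
    (e2 : t * TB + s * SB = NB * A + N * AB) :
    t * (2 * N * M₂ / A ^ 2 * quotDeriv N M₁ A NB TB AB
        - 2 * N * M₁ / A ^ 2 * quotDeriv N M₂ A NB SB AB)
      - (2 * N * NB * A - N ^ 2 * AB) / A ^ 2 * (2 * N * M₂ / A ^ 2) =
      -(4 * N ^ 3 / A ^ 4) * (SB * A - 3 / 2 * M₂ * AB) := by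
  simp only [quotDeriv]
  linear_combination (norm := (field_simp; ring)) 4 * N ^ 2 / A ^ 4 * (M₂ * e2 - SB * e1)

lemma cross_quotDeriv_right (hA : A ≠ 0) (e1 : t * M₁ + s * M₂ = N * A)
    (e2 : t * TB + s * SB = NB * A + N * AB) :
    s * (2 * N * M₂ / A ^ 2 * quotDeriv N M₁ A NB TB AB
        - 2 * N * M₁ / A ^ 2 * quotDeriv N M₂ A NB SB AB)
      + (2 * N * NB * A - N ^ 2 * AB) / A ^ 2 * (2 * N * M₁ / A ^ 2) =
      4 * N ^ 3 / A ^ 4 * (TB * A - 3 / 2 * M₁ * AB) := by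
  simp only [quotDeriv]
  linear_combination (norm := (field_simp; ring)) 4 * N ^ 2 / A ^ 4 * (TB * e1 - M₁ * e2)

/-- The exterior derivatives `Dθ`, `Dη` of the coframe vanish once
`α² (gradT Dθ + gradS Dη)` is divisible by `quadK` with cubic quotient. -/
lemma eq_zero_of_quadK_dvd {Dθ Dη c₀ c₁ c₂ c₃ : ℝ} (hp : p ≠ 0) (hq : q ≠ 0)
    (hε : ε * B ≠ 0) (h1 : 1 + 2 * ε * B ≠ 0) (h2 : 1 - ε * B ≠ 0)
    (h : ∀ t s : ℝ, t ≠ 0 ∨ s ≠ 0 →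
      quadA p q t s * (gradT ε B p q t s * Dθ + gradS ε B p q t s * Dη) =
        quadK ε B p q t s * (c₀ * t ^ 3 + c₁ * t ^ 2 * s + c₂ * t * s ^ 2 + c₃ * s ^ 3)) :
    Dθ = 0 ∧ Dη = 0 := by
  have h10 := h 1 0 (by norm_num)
  have h01 := h 0 1 (by norm_num)
  have h11 := h 1 1 (by norm_num)
  have h1m := h 1 (-1) (by norm_num)
  have h12 := h 1 2 (by norm_num)
  have h1n := h 1 (-2) (by norm_num)
  have h21 := h 2 1 (by norm_num)
  have h2m := h 2 (-1) (by norm_num)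
  simp only [quadA, gradT, gradS, quadK] at *
  obtain ⟨e, he⟩ : ∃ e, e = ε * B := ⟨_, rfl⟩
  simp only [mul_assoc 2 ε B, ← he] at hε h1 h2 h10 h01 h11 h1m h12 h1n h21 h2m
  constructor
  · have a0 : p ^ 3 * (1 + e) * Dθ = (1 - e) * p * c₀ := by linear_combination h10
    have a2 : (1 + 2 * e) * q * (p * q * Dθ) = (1 + 2 * e) * q * c₂ := by
      linear_combination (h12 + h1n) / 24 - (h11 + h1m) / 6 + 1 / 4 * h10
    have a2' := mul_left_cancel₀ (mul_ne_zero h1 hq) a2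
    have a1 : p ^ 2 * q * (2 + 3 * e) * Dθ = (1 - e) * p * c₂ + (1 + 2 * e) * q * c₀ := by
      linear_combination (h11 + h1m) / 2 - a0 - a2
    have : 6 * e ^ 2 * p ^ 3 * q * Dθ = 0 := by
      linear_combination (1 + 2 * e) * q * a0 - (1 - e) * p * a1 + (1 - e) ^ 2 * p ^ 2 * a2'
    simpa [hp, hq, hε] using this
  · have a0 : q ^ 3 * Dη = (1 + 2 * e) * q * c₃ := by linear_combination h01
    have a2 : (1 - e) * p * (p * q * Dη) = (1 - e) * p * c₁ := by
      linear_combination (h21 - h2m) / 24 - (h11 - h1m) / 6 + 1 / 4 * h01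
    have a2' := mul_left_cancel₀ (mul_ne_zero h2 hp) a2
    have a1 : p * q ^ 2 * (2 - e) * Dη = (1 - e) * p * c₃ + (1 + 2 * e) * q * c₁ := by
      linear_combination (h11 - h1m) / 2 - a0 - a2
    have : 6 * e ^ 2 * p * q ^ 3 * Dη = 0 := by
      linear_combination (1 - e) * p * a0 + (1 + 2 * e) ^ 2 * q ^ 2 * a2' - (1 + 2 * e) * q * a1
    simpa [hp, hq, hε] using this

end Algebra

namespace CoframeData

variable {ε : ℝ} {U : Set Pt} {F : Pt → (Fin 2 → ℝ) → ℝ} {B : Pt → ℝ} {θ η : Pt → Pt}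
  {x y : Pt}

lemma gMat_det (h : CoframeData ε U F B θ η) (hx : x ∈ U) (hy : y ≠ 0) :
    (gMat F x y).det = 1 / 4 *
      (4 * coefP ε (B x) * coefQ ε (B x) *
        quadN ε (B x) (coefP ε (B x)) (coefQ ε (B x)) (linForm (θ x) y) (linForm (η x) y) ^ 3 *
        quadK ε (B x) (coefP ε (B x)) (coefQ ε (B x)) (linForm (θ x) y) (linForm (η x) y) /
        quadA (coefP ε (B x)) (coefQ ε (B x)) (linForm (θ x) y) (linForm (η x) y) ^ 4) *
      (θ x 0 * η x 1 - θ x 1 * η x 0) ^ 2 := by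
  rw [← hessian_det (h.quadA_pos hx hy).ne', Matrix.det_fin_two]
  simp only [h.gMat_apply hx hy]
  ring

lemma quadK_pos (h : CoframeData ε U F B θ η) (hx : x ∈ U) (hy : y ≠ 0) :
    0 < quadK ε (B x) (coefP ε (B x)) (coefQ ε (B x)) (linForm (θ x) y) (linForm (η x) y) :=
  diag_pos (mul_pos (h.adm x hx).2.2 (h.adm x hx).coefP_pos)
    (mul_pos (h.adm x hx).2.1 (h.adm x hx).coefQ_pos) (h.linForm_ne hx hy)

lemma quadN_pos (h : CoframeData ε U F B θ η) (hx : x ∈ U) (hε : ε = 1 ∨ ε = -1) (hy : y ≠ 0) :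
    0 < quadN ε (B x) (coefP ε (B x)) (coefQ ε (B x)) (linForm (θ x) y) (linForm (η x) y) := by
  obtain ⟨h0, h1, h2⟩ := h.adm x hx
  have h3 : 0 < 1 + ε * B x := by rcases hε with rfl | rfl <;> linarith
  exact diag_pos (mul_pos h3 (h.adm x hx).coefP_pos) (h.adm x hx).coefQ_pos (h.linForm_ne hx hy)

/-- The cross product of `F²`'s vertical gradient with `sprayForce`, in the coframe. -/
lemma cross_force (h : CoframeData ε U F B θ η) (hx : x ∈ U)
    (hε : ε = 1 ∨ ε = -1) (hy : y ≠ 0) {p q t s : ℝ} (hp : p = coefP ε (B x))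
    (hq : q = coefQ ε (B x)) (ht : t = linForm (θ x) y) (hs : s = linForm (η x) y) :
    quadA p q t s *
        (gradT ε (B x) p q t s * (pd (fun z => θ z 0) 1 x - pd (fun z => θ z 1) 0 x) +
          gradS ε (B x) p q t s * (pd (fun z => η z 0) 1 x - pd (fun z => η z 1) 0 x)) =
      quadK ε (B x) p q t s *
        (2 * p * q * (θ x 0 * η x 1 - θ x 1 * η x 0) ^ 2 *
            (spray F 0 x y * y 1 - spray F 1 x y * y 0)
          - p * q * (θ x 0 * η x 1 - θ x 1 * η x 0) *
            (s * ((y 0 * pd (fun z => θ z 0) 0 x + y 1 * pd (fun z => θ z 1) 0 x) * y 0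
                + (y 0 * pd (fun z => θ z 0) 1 x + y 1 * pd (fun z => θ z 1) 1 x) * y 1)
              - t * ((y 0 * pd (fun z => η z 0) 0 x + y 1 * pd (fun z => η z 1) 0 x) * y 0
                + (y 0 * pd (fun z => η z 0) 1 x + y 1 * pd (fun z => η z 1) 1 x) * y 1))
          + (pd B 0 x * η x 1 - pd B 1 x * η x 0) *
            (q * s * ((1 + 11 * ε * B x) * p * t ^ 2 + (1 + 2 * ε * B x) * q * s ^ 2) /
              (2 * B x * (1 + 2 * ε * B x) * (1 - ε * B x)))
          - (θ x 0 * pd B 1 x - θ x 1 * pd B 0 x) *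
            (p * t * ((1 - ε * B x) * p * t ^ 2 + (1 - 10 * ε * B x) * q * s ^ 2) /
              (2 * B x * (1 + 2 * ε * B x) * (1 - ε * B x)))) := by
  have ad := h.adm x hx
  have hA := (h.quadA_pos hx hy).ne'
  have hK := (h.quadK_pos hx hy).ne'
  have hN := (h.quadN_pos hx hε hy).ne'
  have hdet := h.gMat_det hx hy
  have hg : (gMat F x y).det ≠ 0 := by
    rw [hdet]
    have := ad.coefP_pos.ne'
    have := ad.coefQ_pos.ne'
    have := h.det_ne x hx
    positivity
  have hcross := spray_cross hg
  have hX : ∀ l, sprayForce F x y l = _ := fun l => by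
    rw [sprayForce, h.fderiv_sq_base hx hy, Fin.sum_univ_two, h.fderiv_fderiv_sq hx hy,
      h.fderiv_fderiv_sq hx hy]
  rw [hdet] at hcross
  rw [← hp, ← hq, ← ht, ← hs] at hA hK hN hcross
  simp only [energyT, energyS, energyB, ← hp, ← hq, ← ht, ← hs] at hX
  have eT := euler_energyT (ε := ε) (B := B x) hA
  have eS := euler_energyS (ε := ε) (B := B x) hA
  have eN := euler_quadN (ε := ε) (B := B x) (p := p) (q := q) (t := t) (s := s)
  have eNB := euler_quadNB (ε := ε) (B := B x) (p := p) (q := q) (t := t) (s := s)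
  have kT := gradTB_mod_quadK (p := p) (q := q) (t := t) (s := s) hε ad.ne_zero ad.ne_one ad.ne_two
  have kS := gradSB_mod_quadK (p := p) (q := q) (t := t) (s := s) hε ad.ne_zero ad.ne_one ad.ne_two
  have bL := cross_quotDeriv_left hA eN eNB
  have bR := cross_quotDeriv_right hA eN eNB
  have hE2 : t * (2 * quadN ε (B x) p q t s * gradT ε (B x) p q t s / quadA p q t s ^ 2) +
      s * (2 * quadN ε (B x) p q t s * gradS ε (B x) p q t s / quadA p q t s ^ 2) =
      2 * quadN ε (B x) p q t s ^ 2 / quadA p q t s := by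
    linear_combination (norm := (field_simp; ring))
      2 * quadN ε (B x) p q t s / quadA p q t s ^ 2 * eN
  have key := cross_force_identity (ht.trans (linForm_apply _ _)) (hs.trans (linForm_apply _ _))
    eT eS hE2 rfl (hX 0) (hX 1)
  have ht' := ht.trans (linForm_apply _ _)
  have hs' := hs.trans (linForm_apply _ _)
  have row : ∀ l, gMat F x y l 0 * y 0 + gMat F x y l 1 * y 1 = 1 / 2 *
      (2 * quadN ε (B x) p q t s * gradT ε (B x) p q t s / quadA p q t s ^ 2 * θ x l +
        2 * quadN ε (B x) p q t s * gradS ε (B x) p q t s / quadA p q t s ^ 2 * η x l) := by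
    intro l
    simp only [h.gMat_apply hx hy, ← hp, ← hq, ← ht, ← hs]
    rw [← eT, ← eS]
    generalize energyTT ε (B x) p q t s = TT
    generalize energyTS ε (B x) p q t s = TS
    generalize energySS ε (B x) p q t s = SS
    rw [ht', hs']
    ring
  simp only [row] at hcross
  rw [energyTB, energySB, bL, bR, kT, kS, hessian_det hA] at key
  generalize sprayForce F x y 0 = X₀ at *
  generalize sprayForce F x y 1 = X₁ at *
  generalize spray F 0 x y * y 1 - spray F 1 x y * y 0 = P at *
  clear bL bR eT eS kT kS eN eNB hE2 row hg hdet hX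
  generalize quadN ε (B x) p q t s = N at *
  generalize quadK ε (B x) p q t s = K at *
  generalize quadA p q t s = A at *
  generalize gradT ε (B x) p q t s = M₁ at *
  generalize gradS ε (B x) p q t s = M₂ at *
  linear_combination (norm := (field_simp; ring)) -A ^ 4 / (4 * N ^ 3) * (2 * hcross + key)

end CoframeData

/-- A function that agrees with its cubic interpolant is a cubic form. -/
lemma exists_cubic_coeffs {f : ℝ → ℝ → ℝ}
    (hf : ∀ t s, f t s = f 1 0 * t ^ 3 + ((f 1 1 - f 1 (-1)) / 2 - f 0 1) * t ^ 2 * s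
      + ((f 1 1 + f 1 (-1)) / 2 - f 1 0) * t * s ^ 2 + f 0 1 * s ^ 3) :
    ∃ c₀ c₁ c₂ c₃ : ℝ, ∀ t s,
      f t s = c₀ * t ^ 3 + c₁ * t ^ 2 * s + c₂ * t * s ^ 2 + c₃ * s ^ 3 :=
  ⟨_, _, _, _, hf⟩

/-- The quotient by `quadK` in `CoframeData.cross_force` is a cubic form in `(t, s)` when the
coordinates `y₀ = a t + b s` and `y₁ = c t + d s` are expressed through the coframe. -/
lemma exists_cubic_quotient (a b c d c₀ c₁ c₂ c₃ l m u v u₁ u₂ v₁ v₂ p q k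
    θ₀₀ θ₀₁ θ₁₀ θ₁₁ η₀₀ η₀₁ η₁₀ η₁₁ : ℝ) :
    ∃ d₀ d₁ d₂ d₃ : ℝ, ∀ t s,
      l * (c₀ * (a * t + b * s) ^ 3 + c₁ * (a * t + b * s) ^ 2 * (c * t + d * s)
          + c₂ * (a * t + b * s) * (c * t + d * s) ^ 2 + c₃ * (c * t + d * s) ^ 3)
        - m * (s * (((a * t + b * s) * θ₀₀ + (c * t + d * s) * θ₁₀) * (a * t + b * s)
            + ((a * t + b * s) * θ₀₁ + (c * t + d * s) * θ₁₁) * (c * t + d * s))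
          - t * (((a * t + b * s) * η₀₀ + (c * t + d * s) * η₁₀) * (a * t + b * s)
            + ((a * t + b * s) * η₀₁ + (c * t + d * s) * η₁₁) * (c * t + d * s)))
        + u * (q * s * (u₁ * p * t ^ 2 + u₂ * q * s ^ 2) / k)
        - v * (p * t * (v₁ * p * t ^ 2 + v₂ * q * s ^ 2) / k) =
      d₀ * t ^ 3 + d₁ * t ^ 2 * s + d₂ * t * s ^ 2 + d₃ * s ^ 3 := by
  apply exists_cubic_coeffs
  intro t s
  ring

/-- For a Douglas metric both forms of the coframe are closed. -/
theorem CoframeData.closed {ε : ℝ} {U : Set Pt} {F : Pt → (Fin 2 → ℝ) → ℝ} {B : Pt → ℝ}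
    {θ η : Pt → Pt} (h : CoframeData ε U F B θ η) (hε : ε = 1 ∨ ε = -1) (hD : IsDouglasOn F U)
    {x : Pt} (hx : x ∈ U) :
    pd (fun z => θ z 0) 1 x = pd (fun z => θ z 1) 0 x ∧
      pd (fun z => η z 0) 1 x = pd (fun z => η z 1) 0 x := by
  obtain ⟨c₀, c₁, c₂, c₃, hc⟩ := hD x hx
  have ad := h.adm x hx
  have hJ := h.det_ne x hx
  have hcross := fun y hy => h.cross_force hx (y := y) hε hy rfl rfl rfl rfl
  obtain ⟨d₀, d₁, d₂, d₃, hd⟩ : ∃ d₀ d₁ d₂ d₃ : ℝ, ∀ t s : ℝ, t ≠ 0 ∨ s ≠ 0 →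
      quadA (coefP ε (B x)) (coefQ ε (B x)) t s *
        (gradT ε (B x) (coefP ε (B x)) (coefQ ε (B x)) t s *
            (pd (fun z => θ z 0) 1 x - pd (fun z => θ z 1) 0 x) +
          gradS ε (B x) (coefP ε (B x)) (coefQ ε (B x)) t s *
            (pd (fun z => η z 0) 1 x - pd (fun z => η z 1) 0 x)) =
      quadK ε (B x) (coefP ε (B x)) (coefQ ε (B x)) t s *
        (d₀ * t ^ 3 + d₁ * t ^ 2 * s + d₂ * t * s ^ 2 + d₃ * s ^ 3) := by
    obtain ⟨J, hJJ⟩ : ∃ J, J = θ x 0 * η x 1 - θ x 1 * η x 0 := ⟨_, rfl⟩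
    rw [← hJJ] at hJ
    simp only [← hJJ] at hcross
    obtain ⟨d₀, d₁, d₂, d₃, hd⟩ := exists_cubic_quotient (η x 1 / J) (-(θ x 1) / J)
      (-(η x 0) / J) (θ x 0 / J) c₀ c₁ c₂ c₃ (2 * coefP ε (B x) * coefQ ε (B x) * J ^ 2)
      (coefP ε (B x) * coefQ ε (B x) * J) (pd B 0 x * η x 1 - pd B 1 x * η x 0)
      (θ x 0 * pd B 1 x - θ x 1 * pd B 0 x) (1 + 11 * ε * B x) (1 + 2 * ε * B x) (1 - ε * B x)
      (1 - 10 * ε * B x) (coefP ε (B x)) (coefQ ε (B x))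
      (2 * B x * (1 + 2 * ε * B x) * (1 - ε * B x))
      (pd (fun z => θ z 0) 0 x) (pd (fun z => θ z 0) 1 x) (pd (fun z => θ z 1) 0 x)
      (pd (fun z => θ z 1) 1 x) (pd (fun z => η z 0) 0 x) (pd (fun z => η z 0) 1 x)
      (pd (fun z => η z 1) 0 x) (pd (fun z => η z 1) 1 x)
    refine ⟨d₀, d₁, d₂, d₃, fun t s hts => ?_⟩
    obtain ⟨y, hy0, hy1⟩ : ∃ y : Pt, y 0 = η x 1 / J * t + -(θ x 1) / J * s ∧
        y 1 = -(η x 0) / J * t + θ x 0 / J * s := ⟨![_, _], rfl, rfl⟩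
    have hθ : linForm (θ x) y = t := by
      rw [linForm_apply, hy0, hy1]
      field_simp
      rw [hJJ]
      ring
    have hη : linForm (η x) y = s := by
      rw [linForm_apply, hy0, hy1]
      field_simp
      rw [hJJ]
      ring
    have hy : y ≠ 0 := by
      rintro rfl
      rw [map_zero] at hθ hη
      rcases hts with hts | hts
      exacts [hts hθ.symm, hts hη.symm]
    have := hcross y hy
    rwa [hc y hy, hθ, hη, hy0, hy1, hd] at this
  have hεB : ε * B x ≠ 0 := mul_ne_zero (by rcases hε with rfl | rfl <;> norm_num) ad.ne_zero
  obtain ⟨h1, h2⟩ := eq_zero_of_quadK_dvd ad.coefP_pos.ne' ad.coefQ_pos.ne' hεB ad.ne_one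
    ad.ne_two hd
  exact ⟨sub_eq_zero.1 h1, sub_eq_zero.1 h2⟩

/-- `b²` in terms of the entries of a symmetric metric. -/
def normSqFormula (m : Matrix (Fin 2) (Fin 2) ℝ) (c : Pt) : ℝ :=
  (m 1 1 * c 0 ^ 2 - 2 * m 0 1 * c 0 * c 1 + m 0 0 * c 1 ^ 2) / m.det

lemma bsq_eq_normSqFormula {a : Pt → Matrix (Fin 2) (Fin 2) ℝ} (b : Pt → Fin 2 → ℝ) {x : Pt}
    (hsym : a x 0 1 = a x 1 0) : bsq a b x = normSqFormula (a x) (b x) := by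
  simp only [bsq, bUp, normSqFormula, Matrix.inv_def, Ring.inverse_eq_inv',
    Matrix.adjugate_fin_two, Fin.sum_univ_two, Matrix.smul_apply, smul_eq_mul, Matrix.of_apply,
    Matrix.cons_val', Matrix.cons_val_zero, Matrix.cons_val_one, Matrix.cons_val_fin_one, hsym]
  ring

lemma normSqFormula_pos {m : Matrix (Fin 2) (Fin 2) ℝ} {c : Pt} (hm : m.PosDef)
    (hsym : m 0 1 = m 1 0) (hc : c ≠ 0) : 0 < normSqFormula m c := by
  have h00 : 0 < m 0 0 := hm.diag_pos
  have hdet := hm.det_pos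
  have hdet' : m.det = m 0 0 * m 1 1 - m 0 1 ^ 2 := by rw [Matrix.det_fin_two, ← hsym]; ring
  refine div_pos (pos_of_mul_pos_right (a := m 0 0) ?_ h00.le) hdet
  have h : m 0 0 * (m 1 1 * c 0 ^ 2 - 2 * m 0 1 * c 0 * c 1 + m 0 0 * c 1 ^ 2) =
      m.det * c 0 ^ 2 + 1 * (m 0 0 * c 1 - m 0 1 * c 0) ^ 2 := by
    rw [hdet']
    ring
  rw [h]
  refine diag_pos hdet one_pos ?_
  by_contra! hz
  apply hc
  have h1 : c 1 = 0 := by simpa [hz.1, h00.ne'] using hz.2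
  ext i
  fin_cases i <;> simp [hz.1, h1]

/-- The first form of the normalised coframe, proportional to `β`. -/
def coframeT (ε B : ℝ) (c : Pt) : Pt := fun i => (1 + 2 * ε * B) ^ ((3 : ℝ) / 2) / B * c i

/-- The second form of the normalised coframe, orthogonal to `β`. -/
def coframeS (ε B : ℝ) (m : Matrix (Fin 2) (Fin 2) ℝ) (c : Pt) : Pt := fun i =>
  (1 - ε * B) ^ ((3 : ℝ) / 2) / (B * √m.det) * (m i 1 * c 0 - m i 0 * c 1)

lemma rpow_three_halves_sq {r : ℝ} (hr : 0 ≤ r) : (r ^ ((3 : ℝ) / 2)) ^ 2 = r ^ 3 := by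
  rw [← Real.rpow_natCast, ← Real.rpow_mul hr, ← Real.rpow_natCast]
  norm_num

section Coframe

variable {ε B : ℝ} {m : Matrix (Fin 2) (Fin 2) ℝ} {c : Pt}

lemma coframe_det_ne (ad : Admissible ε B) (hdet : 0 < m.det) (hsym : m 0 1 = m 1 0)
    (hB : B = normSqFormula m c) :
    coframeT ε B c 0 * coframeS ε B m c 1 - coframeT ε B c 1 * coframeS ε B m c 0 ≠ 0 := by
  have h1 := (Real.rpow_pos_of_pos ad.2.1 ((3 : ℝ) / 2)).ne'
  have h2 := (Real.rpow_pos_of_pos ad.2.2 ((3 : ℝ) / 2)).ne'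
  have h3 := (Real.sqrt_pos.2 hdet).ne'
  have h0 := ad.ne_zero
  have hBd : B * m.det = m 1 1 * c 0 ^ 2 - 2 * m 0 1 * c 0 * c 1 + m 0 0 * c 1 ^ 2 := by
    rw [hB, normSqFormula, div_mul_cancel₀ _ hdet.ne']
  have h4 : coframeT ε B c 0 * coframeS ε B m c 1 - coframeT ε B c 1 * coframeS ε B m c 0 =
      (1 + 2 * ε * B) ^ ((3 : ℝ) / 2) / B * ((1 - ε * B) ^ ((3 : ℝ) / 2) / (B * √m.det)) *
        (B * m.det) := by
    rw [hBd]
    simp only [coframeT, coframeS, ← hsym]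
    ring
  rw [h4]
  have := hdet.ne'
  positivity

lemma quadA_coframe (ad : Admissible ε B) (hdet : 0 < m.det) (hsym : m 0 1 = m 1 0)
    (hB : B = normSqFormula m c) (y : Pt) :
    quadA (coefP ε B) (coefQ ε B) (linForm (coframeT ε B c) y) (linForm (coframeS ε B m c) y) =
      ∑ i, ∑ j, m i j * y i * y j := by
  have h0 := ad.ne_zero
  have h1 := ad.ne_one
  have h2 := ad.ne_two
  have h3 := rpow_three_halves_sq ad.2.1.le
  have h4 := rpow_three_halves_sq ad.2.2.le
  have h5 := Real.sq_sqrt hdet.le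
  have h6 := (Real.sqrt_pos.2 hdet).ne'
  have hBd : B * m.det = m 1 1 * c 0 ^ 2 - 2 * m 0 1 * c 0 * c 1 + m 0 0 * c 1 ^ 2 := by
    rw [hB, normSqFormula, div_mul_cancel₀ _ hdet.ne']
  have hd : m.det = m 0 0 * m 1 1 - m 0 1 ^ 2 := by rw [Matrix.det_fin_two, ← hsym]; ring
  have hT : coefP ε B * linForm (coframeT ε B c) y ^ 2 = (c 0 * y 0 + c 1 * y 1) ^ 2 / B := by
    have : linForm (coframeT ε B c) y =
        (1 + 2 * ε * B) ^ ((3 : ℝ) / 2) / B * (c 0 * y 0 + c 1 * y 1) := by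
      simp only [linForm_apply, coframeT]
      ring
    rw [this, mul_pow, div_pow, h3, coefP]
    generalize 1 + 2 * ε * B = r at *
    field_simp
  have hS : coefQ ε B * linForm (coframeS ε B m c) y ^ 2 =
      ((m 0 1 * c 0 - m 0 0 * c 1) * y 0 + (m 1 1 * c 0 - m 0 1 * c 1) * y 1) ^ 2 /
        (B * m.det) := by
    have : linForm (coframeS ε B m c) y = (1 - ε * B) ^ ((3 : ℝ) / 2) / (B * √m.det) *
        ((m 0 1 * c 0 - m 0 0 * c 1) * y 0 + (m 1 1 * c 0 - m 0 1 * c 1) * y 1) := by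
      simp only [linForm_apply, coframeS, ← hsym]
      ring
    have hdne := hdet.ne'
    rw [this, mul_pow, div_pow, h4, mul_pow, h5, coefQ]
    generalize 1 - ε * B = r at *
    field_simp
  have hdne := hdet.ne'
  rw [quadA, hT, hS]
  simp only [Fin.sum_univ_two, ← hsym]
  have hsum : (c 0 * y 0 + c 1 * y 1) ^ 2 / B =
    (c 0 * y 0 + c 1 * y 1) ^ 2 * m.det / (B * m.det) := by field_simp
  rw [hsum, ← add_div, div_eq_iff (mul_ne_zero h0 hdne), hBd, hd]
  ring

lemma beta_coframe (ad : Admissible ε B) (y : Pt) :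
    c 0 * y 0 + c 1 * y 1 =
      B / (1 + 2 * ε * B) ^ ((3 : ℝ) / 2) * linForm (coframeT ε B c) y := by
  have h1 := (Real.rpow_pos_of_pos ad.2.1 ((3 : ℝ) / 2)).ne'
  have h0 := ad.ne_zero
  simp only [linForm_apply, coframeT]
  generalize (1 + 2 * ε * B) ^ ((3 : ℝ) / 2) = r at *
  field_simp

end Coframe

lemma sq_metric_eq_energy {ε B A β t s : ℝ} (hA : 0 ≤ A)
    (hA' : quadA (coefP ε B) (coefQ ε B) t s = A) (hβ : β ^ 2 = B * coefP ε B * t ^ 2) :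
    (√A + ε * β ^ 2 / √A) ^ 2 = energy ε B t s := by
  have hN : quadN ε B (coefP ε B) (coefQ ε B) t s = A + ε * β ^ 2 := by
    rw [← hA', hβ, quadN, quadA]
    ring
  rw [energy, hN, hA']
  rcases hA.eq_or_lt with rfl | hA
  · simp
  · have h := (Real.sqrt_pos.2 hA).ne'
    have h' := Real.sq_sqrt hA.le
    generalize √A = r at *
    rw [← h']
    field_simp

lemma admissible_of_regular {ε B b₀ : ℝ} (hε : ε = 1 ∨ ε = -1) (hB : 0 < B) (hBb : B < b₀ ^ 2)
    (hb₀ : 0 < b₀) (hreg : ∀ ρ s : ℝ, |s| ≤ ρ → ρ < b₀ →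
      (1 + ε*s^2) - s * (2*ε*s) + (ρ^2 - s^2) * (2*ε) > 0) : Admissible ε B := by
  have hρ : √B < b₀ := (Real.sqrt_lt' hb₀).2 hBb
  have hsq := Real.sq_sqrt hB.le
  have h1 := hreg (√B) (√B) (abs_of_nonneg (Real.sqrt_nonneg B)).le hρ
  have h2 := hreg (√B) 0 (by simp) hρ
  rcases hε with rfl | rfl
  · exact ⟨hB, by linarith, by nlinarith⟩
  · exact ⟨hB, by nlinarith, by linarith⟩

section Construction

variable {ε b₀ : ℝ} {U : Set Pt} {a : Pt → Matrix (Fin 2) (Fin 2) ℝ} {b : Pt → Fin 2 → ℝ}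

lemma contDiffOn_det (ha : ∀ i j, ContDiffOn ℝ (⊤ : ℕ∞) (fun x => a x i j) U) :
    ContDiffOn ℝ (⊤ : ℕ∞) (fun x => (a x).det) U := by
  simp only [Matrix.det_fin_two]
  exact ((ha 0 0).mul (ha 1 1)).sub ((ha 0 1).mul (ha 1 0))

lemma contDiffOn_bsq (ha : ∀ i j, ContDiffOn ℝ (⊤ : ℕ∞) (fun x => a x i j) U)
    (hsym : ∀ x ∈ U, ∀ i j, a x i j = a x j i) (hpos : ∀ x ∈ U, (a x).PosDef)
    (hb : ∀ i, ContDiffOn ℝ (⊤ : ℕ∞) (fun x => b x i) U) :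
    ContDiffOn ℝ (⊤ : ℕ∞) (bsq a b) U := by
  refine ContDiffOn.congr ?_ fun x hx => bsq_eq_normSqFormula b (hsym x hx 0 1)
  refine ContDiffOn.div ?_ (contDiffOn_det ha) fun x hx => (hpos x hx).det_pos.ne'
  exact (((ha 1 1).mul ((hb 0).pow 2)).sub
    (((contDiffOn_const.mul (ha 0 1)).mul (hb 0)).mul (hb 1))).add ((ha 0 0).mul ((hb 1).pow 2))

lemma contDiffOn_coframeT {B : Pt → ℝ} (hB : ContDiffOn ℝ (⊤ : ℕ∞) B U)
    (ad : ∀ x ∈ U, Admissible ε (B x))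
    (hb : ∀ i, ContDiffOn ℝ (⊤ : ℕ∞) (fun x => b x i) U) (i : Fin 2) :
    ContDiffOn ℝ (⊤ : ℕ∞) (fun x => coframeT ε (B x) (b x) i) U :=
  ((((contDiffOn_const.add (contDiffOn_const.mul hB)).rpow_const_of_ne
    fun x hx => (ad x hx).ne_one).div hB fun x hx => (ad x hx).ne_zero)).mul (hb i)

lemma contDiffOn_coframeS {B : Pt → ℝ} (hB : ContDiffOn ℝ (⊤ : ℕ∞) B U)
    (ad : ∀ x ∈ U, Admissible ε (B x))
    (ha : ∀ i j, ContDiffOn ℝ (⊤ : ℕ∞) (fun x => a x i j) U) (hpos : ∀ x ∈ U, (a x).PosDef)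
    (hb : ∀ i, ContDiffOn ℝ (⊤ : ℕ∞) (fun x => b x i) U) (i : Fin 2) :
    ContDiffOn ℝ (⊤ : ℕ∞) (fun x => coframeS ε (B x) (a x) (b x) i) U := by
  refine ContDiffOn.mul (ContDiffOn.div ?_ (hB.mul ?_) ?_)
    (((ha i 1).mul (hb 0)).sub ((ha i 0).mul (hb 1)))
  · exact (contDiffOn_const.sub (contDiffOn_const.mul hB)).rpow_const_of_ne
      fun x hx => (ad x hx).ne_two
  · exact (contDiffOn_det ha).sqrt fun x hx => (hpos x hx).det_pos.ne'
  · exact fun x hx => mul_ne_zero (ad x hx).ne_zero (Real.sqrt_pos.2 (hpos x hx).det_pos).ne'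

lemma quadA_coframe_bsq {x : Pt} (ad : Admissible ε (bsq a b x)) (hpos : (a x).PosDef)
    (hsym : a x 0 1 = a x 1 0) (y : Pt) :
    alphaF a x y ^ 2 = quadA (coefP ε (bsq a b x)) (coefQ ε (bsq a b x))
      (linForm (coframeT ε (bsq a b x) (b x)) y)
      (linForm (coframeS ε (bsq a b x) (a x) (b x)) y) := by
  have h := quadA_coframe ad hpos.det_pos hsym (bsq_eq_normSqFormula b hsym) y
  rw [alphaF, ← h, Real.sq_sqrt]
  exact add_nonneg (mul_nonneg ad.coefP_pos.le (sq_nonneg _))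
    (mul_nonneg ad.coefQ_pos.le (sq_nonneg _))

lemma betaF_coframe {x : Pt} (ad : Admissible ε (bsq a b x)) (y : Pt) :
    betaF b x y = bsq a b x / (1 + 2 * ε * bsq a b x) ^ ((3 : ℝ) / 2) *
      linForm (coframeT ε (bsq a b x) (b x)) y := by
  rw [← beta_coframe ad, betaF, Fin.sum_univ_two]

lemma coframeData (hU : IsOpen U) (ha : ∀ i j, ContDiffOn ℝ (⊤ : ℕ∞) (fun x => a x i j) U)
    (hsym : ∀ x ∈ U, ∀ i j, a x i j = a x j i) (hpos : ∀ x ∈ U, (a x).PosDef)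
    (hb : ∀ i, ContDiffOn ℝ (⊤ : ℕ∞) (fun x => b x i) U)
    (ad : ∀ x ∈ U, Admissible ε (bsq a b x)) :
    CoframeData ε U (fun x y => alphaF a x y + ε * (betaF b x y)^2 / alphaF a x y) (bsq a b)
      (fun x => coframeT ε (bsq a b x) (b x)) (fun x => coframeS ε (bsq a b x) (a x) (b x)) where
  isOpen := hU
  adm := ad
  det_ne x hx := coframe_det_ne (ad x hx) (hpos x hx).det_pos (hsym x hx 0 1)
    (bsq_eq_normSqFormula b (hsym x hx 0 1))
  diffB x hx := ((contDiffOn_bsq ha hsym hpos hb).contDiffAt (hU.mem_nhds hx)).differentiableAt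
    (by simp)
  diffθ x hx i := ((contDiffOn_coframeT (contDiffOn_bsq ha hsym hpos hb) ad hb i).contDiffAt
    (hU.mem_nhds hx)).differentiableAt (by simp)
  diffη x hx i := ((contDiffOn_coframeS (contDiffOn_bsq ha hsym hpos hb) ad ha hpos hb
    i).contDiffAt (hU.mem_nhds hx)).differentiableAt (by simp)
  sq_eq x hx y := by
    have hA := quadA_coframe_bsq (ad x hx) (hpos x hx) (hsym x hx 0 1) y
    have hβ : betaF b x y ^ 2 = bsq a b x * coefP ε (bsq a b x) *
        linForm (coframeT ε (bsq a b x) (b x)) y ^ 2 := by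
      rw [betaF_coframe (ad x hx), mul_pow, div_pow, rpow_three_halves_sq (ad x hx).2.1.le, coefP]
      ring
    have h := sq_metric_eq_energy (sq_nonneg (alphaF a x y)) hA.symm hβ
    have hα : √(alphaF a x y ^ 2) = alphaF a x y := Real.sqrt_sq (Real.sqrt_nonneg _)
    rwa [hα] at h

end Construction

/-- A smooth closed `1`-form on a convex open set has a smooth potential. -/
lemma exists_potential {W : Set Pt} (hW : IsOpen W) (hconv : Convex ℝ W) {θ : Pt → Pt}
    (hθ : ∀ i, ContDiffOn ℝ (⊤ : ℕ∞) (fun z => θ z i) W)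
    (hc : ∀ x ∈ W, pd (fun z => θ z 0) 1 x = pd (fun z => θ z 1) 0 x) :
    ∃ f : Pt → ℝ, ContDiffOn ℝ (⊤ : ℕ∞) f W ∧ ∀ x ∈ W, HasFDerivAt f (linForm (θ x)) x := by
  have hω : ContDiffOn ℝ (⊤ : ℕ∞) (fun x => linForm (θ x)) W :=
    ((hθ 0).smul contDiffOn_const).add ((hθ 1).smul contDiffOn_const)
  obtain ⟨f, hf⟩ := hconv.exists_forall_hasFDerivAt_of_fderiv_symmetric hW
    (hω.differentiableOn (by simp)) fun x hx v w => by
      have hd : ∀ i, DifferentiableAt ℝ (fun z => θ z i) x := fun i =>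
        ((hθ i).contDiffAt (hW.mem_nhds hx)).differentiableAt (by simp)
      have hsplit : ∀ i v, fderiv ℝ (fun z => θ z i) x v =
          v 0 * pd (fun z => θ z i) 0 x + v 1 * pd (fun z => θ z i) 1 x := by
        intro i v
        have hv : v = v 0 • Pi.single 0 1 + v 1 • Pi.single 1 1 := by
          ext j
          fin_cases j <;> simp
        conv_lhs => rw [hv]
        simp only [map_add, map_smul, smul_eq_mul, pd]
      have hdω : HasFDerivAt (fun x => linForm (θ x)) _ x :=
        ((hd 0).hasFDerivAt.smul_const
          (ContinuousLinearMap.proj (R := ℝ) (φ := fun _ => ℝ) (0 : Fin 2))).add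
        ((hd 1).hasFDerivAt.smul_const
          (ContinuousLinearMap.proj (R := ℝ) (φ := fun _ => ℝ) (1 : Fin 2)))
      rw [hdω.fderiv]
      simp [hsplit, hc x hx]
      ring
  refine ⟨f, ?_, hf⟩
  rw [contDiffOn_infty_iff_fderiv_of_isOpen hW]
  exact ⟨fun x hx => (hf x hx).differentiableAt.differentiableWithinAt,
    hω.congr fun x hx => (hf x hx).fderiv⟩

/-- Two independent linear forms on the plane are the components of an isomorphism. -/
lemma exists_equiv_of_det_ne {c d : Pt} (hJ : c 0 * d 1 - c 1 * d 0 ≠ 0) :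
    ∃ e : Pt ≃L[ℝ] Pt, ∀ y, e y 0 = linForm c y ∧ e y 1 = linForm d y := by
  let L : Pt →ₗ[ℝ] Pt := LinearMap.pi ![(linForm c : Pt →ₗ[ℝ] ℝ), (linForm d : Pt →ₗ[ℝ] ℝ)]
  have hL : Function.Injective L := by
    rw [injective_iff_map_eq_zero]
    intro y hy
    have h0 : c 0 * y 0 + c 1 * y 1 = 0 := by
      rw [← linForm_apply]
      exact congrFun hy 0
    have h1 : d 0 * y 0 + d 1 * y 1 = 0 := by
      rw [← linForm_apply]
      exact congrFun hy 1
    have hy0 : y 0 = 0 := by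
      refine (mul_eq_zero.1 ?_).resolve_left hJ
      linear_combination d 1 * h0 - c 1 * h1
    have hy1 : y 1 = 0 := by
      refine (mul_eq_zero.1 ?_).resolve_left hJ
      linear_combination c 0 * h1 - d 0 * h0
    ext i
    fin_cases i <;> simp [hy0, hy1]
  exact ⟨(LinearEquiv.ofInjectiveEndo L hL).toContinuousLinearEquiv, fun y => ⟨rfl, rfl⟩⟩

/-- A smooth coframe of closed forms is the differential of local coordinates. -/
lemma exists_chart_of_closed {U : Set Pt} (hU : IsOpen U) {θ η : Pt → Pt}
    (hθ : ∀ i, ContDiffOn ℝ (⊤ : ℕ∞) (fun z => θ z i) U)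
    (hη : ∀ i, ContDiffOn ℝ (⊤ : ℕ∞) (fun z => η z i) U)
    (hθc : ∀ x ∈ U, pd (fun z => θ z 0) 1 x = pd (fun z => θ z 1) 0 x)
    (hηc : ∀ x ∈ U, pd (fun z => η z 0) 1 x = pd (fun z => η z 1) 0 x)
    (hJ : ∀ x ∈ U, θ x 0 * η x 1 - θ x 1 * η x 0 ≠ 0) {x₀ : Pt} (hx₀ : x₀ ∈ U) :
    ∃ (V : Set Pt) (ψ : Pt → Pt), IsCoordChart ψ V U ∧ x₀ ∈ ψ '' V ∧
      ∀ z ∈ V, ∀ y, linForm (θ (ψ z)) (fderiv ℝ ψ z y) = y 0 ∧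
        linForm (η (ψ z)) (fderiv ℝ ψ z y) = y 1 := by
  obtain ⟨r, hr, hrU⟩ := Metric.isOpen_iff.1 hU x₀ hx₀
  have hW : IsOpen (Metric.ball x₀ r) := Metric.isOpen_ball
  have hx₀W : x₀ ∈ Metric.ball x₀ r := Metric.mem_ball_self hr
  obtain ⟨f, hf, hf'⟩ := exists_potential hW (convex_ball x₀ r) (fun i => (hθ i).mono hrU)
    fun x hx => hθc x (hrU hx)
  obtain ⟨g, hg, hg'⟩ := exists_potential hW (convex_ball x₀ r) (fun i => (hη i).mono hrU)
    fun x hx => hηc x (hrU hx)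
  choose! e he using fun x (hx : x ∈ Metric.ball x₀ r) => exists_equiv_of_det_ne (hJ x (hrU hx))
  let Φ : Pt → Pt := fun x => ![f x, g x]
  have hΦ : ∀ x ∈ Metric.ball x₀ r, ContDiffAt ℝ (⊤ : ℕ∞) Φ x := by
    intro x hx
    rw [contDiffAt_pi]
    intro i
    fin_cases i
    exacts [hf.contDiffAt (hW.mem_nhds hx), hg.contDiffAt (hW.mem_nhds hx)]
  have hΦ' : ∀ x ∈ Metric.ball x₀ r, HasFDerivAt Φ (e x : Pt →L[ℝ] Pt) x := by
    intro x hx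
    rw [hasFDerivAt_pi']
    intro i
    fin_cases i
    · exact (hf' x hx).congr_fderiv (by ext1 y; exact (he x hx y).1.symm)
    · exact (hg' x hx).congr_fderiv (by ext1 y; exact (he x hx y).2.symm)
  let Ψ := (hΦ x₀ hx₀W).toOpenPartialHomeomorph Φ (hΦ' x₀ hx₀W) (by simp)
  have hderiv : ∀ z ∈ Ψ.target ∩ Ψ.symm ⁻¹' Metric.ball x₀ r,
      HasFDerivAt Ψ.symm ((e (Ψ.symm z)).symm : Pt →L[ℝ] Pt) z := fun z hz =>
    Ψ.hasFDerivAt_symm hz.1 (hΦ' _ hz.2)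
  refine ⟨Ψ.target ∩ Ψ.symm ⁻¹' Metric.ball x₀ r, Ψ.symm,
    ⟨Ψ.isOpen_inter_preimage_symm hW, ?_, ?_, ?_, ?_⟩, ?_, ?_⟩
  · exact fun z hz => (Ψ.contDiffAt_symm hz.1 (hΦ' _ hz.2) (hΦ _ hz.2)).contDiffWithinAt
  · exact Ψ.symm.injOn.mono Set.inter_subset_left
  · rintro _ ⟨z, hz, rfl⟩
    exact hrU hz.2
  · intro z hz
    rw [(hderiv z hz).fderiv]
    exact ((e (Ψ.symm z)).symm.toLinearEquiv.isUnit_det').ne_zero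
  · have hsrc : x₀ ∈ Ψ.source := (hΦ x₀ hx₀W).mem_toOpenPartialHomeomorph_source _ _
    refine ⟨Ψ x₀, ⟨Ψ.map_source hsrc, ?_⟩, Ψ.left_inv hsrc⟩
    rw [Set.mem_preimage, Ψ.left_inv hsrc]
    exact hx₀W
  · intro z hz y
    rw [(hderiv z hz).fderiv]
    obtain ⟨h0, h1⟩ := he _ hz.2 ((e (Ψ.symm z)).symm y)
    rw [ContinuousLinearEquiv.apply_symm_apply] at h0 h1
    exact ⟨h0.symm, h1.symm⟩

/-- `α²` in normal form, with the `β²`-term split off. -/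
lemma quadA_normal_form {ε B : ℝ} (hε : ε = 1 ∨ ε = -1) (h1 : 1 + 2 * ε * B ≠ 0)
    (h2 : 1 - ε * B ≠ 0) (t s : ℝ) :
    quadA (coefP ε B) (coefQ ε B) t s =
      (B * (t ^ 2 + s ^ 2) / (1 ^ 2 + 0 ^ 2)
        - 9 * ε * (1 + ε * B + B ^ 2) * (B ^ 2 / (1 + 2 * ε * B) ^ 3 * t ^ 2)) /
      (1 - ε * B) ^ 3 := by
  have key : (1 - ε * B) ^ 3 = (1 + 2 * ε * B) ^ 3 - 9 * ε * B * (1 + ε * B + B ^ 2) := by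
    rcases hε with rfl | rfl <;> ring
  simp only [quadA, coefP, coefQ]
  generalize 1 + 2 * ε * B = c at *
  generalize 1 - ε * B = d at *
  field_simp
  rw [key]
  ring

/-- Theorem 1.2 of the paper (local structure of Douglas metrics
`F = α ± β²/α` in dimension two). -/
theorem stmt1 (ε : ℝ) (hε : ε = 1 ∨ ε = -1)
    (U : Set Pt) (hU : IsOpen U)
    (a : Pt → Matrix (Fin 2) (Fin 2) ℝ) (b : Pt → Fin 2 → ℝ)
    (ha : ∀ i j, ContDiffOn ℝ (⊤ : ℕ∞) (fun x => a x i j) U)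
    (hsym : ∀ x ∈ U, ∀ i j, a x i j = a x j i)
    (hpos : ∀ x ∈ U, (a x).PosDef)
    (hb : ∀ i, ContDiffOn ℝ (⊤ : ℕ∞) (fun x => b x i) U)
    -- β is nowhere zero
    (hbne : ∀ x ∈ U, b x ≠ 0)
    -- regularity of F = α + ε β²/α (with φ(s) = 1 + ε s²)
    (b₀ : ℝ) (hb₀ : 0 < b₀) (hbb : ∀ x ∈ U, bsq a b x < b₀^2)
    (hreg : ∀ ρ s : ℝ, |s| ≤ ρ → ρ < b₀ →
      (1 + ε*s^2) - s * (2*ε*s) + (ρ^2 - s^2) * (2*ε) > 0)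
    -- F is a Douglas metric
    (hD : IsDouglasOn (fun x y => alphaF a x y + ε * (betaF b x y)^2 / alphaF a x y) U) :
    ∀ x₀ ∈ U, ∃ (V : Set Pt) (ψ : Pt → Pt), IsCoordChart ψ V U ∧ x₀ ∈ ψ '' V ∧
      ∃ B u v : Pt → ℝ,
        ContDiffOn ℝ (⊤ : ℕ∞) B V ∧ ContDiffOn ℝ (⊤ : ℕ∞) u V ∧
        ContDiffOn ℝ (⊤ : ℕ∞) v V ∧
        -- u + iv is a complex analytic function of z = x¹ + ix² (Cauchy–Riemann)
        (∀ z ∈ V, pd u 0 z = pd v 1 z ∧ pd u 1 z = - pd v 0 z) ∧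
        (ε = 1 → ∀ z ∈ V, 0 < B z ∧ B z < 1) ∧
        (ε = -1 → ∀ z ∈ V, 0 < B z ∧ B z < 1/2) ∧
        (∀ z ∈ V, ∀ y : Fin 2 → ℝ,
          (alphaF a (ψ z) (fderiv ℝ ψ z y))^2 =
            (B z * ((y 0)^2 + (y 1)^2) / (u z^2 + v z^2)
              - 9 * ε * (1 + ε * B z + (B z)^2) * (betaF b (ψ z) (fderiv ℝ ψ z y))^2)
            / (1 - ε * B z)^3 ∧
          betaF b (ψ z) (fderiv ℝ ψ z y) =
            B z * (u z * y 0 + v z * y 1)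
              / ((1 + 2 * ε * B z) ^ ((3:ℝ)/2) * (u z^2 + v z^2))) := by
  have hBpos : ∀ x ∈ U, 0 < bsq a b x := fun x hx => by
    rw [bsq_eq_normSqFormula b (hsym x hx 0 1)]
    exact normSqFormula_pos (hpos x hx) (hsym x hx 0 1) (hbne x hx)
  have ad : ∀ x ∈ U, Admissible ε (bsq a b x) := fun x hx =>
    admissible_of_regular hε (hBpos x hx) (hbb x hx) hb₀ hreg
  have hB := contDiffOn_bsq ha hsym hpos hb
  have hdata := coframeData hU ha hsym hpos hb ad
  intro x₀ hx₀
  obtain ⟨V, ψ, hψ, hmem, hform⟩ := exists_chart_of_closed hU (contDiffOn_coframeT hB ad hb)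
    (contDiffOn_coframeS hB ad ha hpos hb) (fun x hx => (hdata.closed hε hD hx).1)
    (fun x hx => (hdata.closed hε hD hx).2) hdata.det_ne hx₀
  have hψU : ∀ z ∈ V, ψ z ∈ U := fun z hz => hψ.2.2.2.1 (Set.mem_image_of_mem ψ hz)
  refine ⟨V, ψ, hψ, hmem, fun z => bsq a b (ψ z), fun _ => 1, fun _ => 0,
    hB.comp hψ.2.1 hψU, contDiffOn_const, contDiffOn_const, ?_, ?_, ?_, ?_⟩
  · intro z _
    simp [pd]
  · rintro rfl z hz
    obtain ⟨h0, -, h2⟩ := ad _ (hψU z hz)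
    exact ⟨h0, by linarith⟩
  · rintro rfl z hz
    obtain ⟨h0, h1, -⟩ := ad _ (hψU z hz)
    exact ⟨h0, by linarith⟩
  · intro z hz y
    have adz := ad _ (hψU z hz)
    have hβ := betaF_coframe adz (fderiv ℝ ψ z y)
    have hα := quadA_coframe_bsq adz (hpos _ (hψU z hz)) (hsym _ (hψU z hz) 0 1) (fderiv ℝ ψ z y)
    rw [(hform z hz y).1] at hβ hα
    rw [(hform z hz y).2] at hα
    have hsq := rpow_three_halves_sq adz.2.1.le
    refine ⟨?_, ?_⟩
    · rw [hα, hβ, mul_pow, div_pow, hsq]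
      exact quadA_normal_form hε adz.ne_one adz.ne_two _ _
    · rw [hβ]
      simp only [one_mul, zero_mul, add_zero, one_pow, ne_eq, OfNat.ofNat_ne_zero,
        not_false_eq_true, zero_pow, mul_one]
      ring

end
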